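/- arXiv:2211.17214 — 9 statements merged into one kernel-verified Lean document; each statement's English description precedes it below -/
import Mathlib

section
/- Let g : {0,1}^m → {0,1} be a k-stifled Boolean function (with k ≥ 1) and let f ⊆ {0,1}^n × R be a relation. Then PDTsize(f ∘ g) ≥ 2^{DT(f)·k}, i.e., every parity decision tree computing f ∘ g has at least 2^{DT(f)·k} leaves. -/
/-- A Boolean function `g` on coordinates `ι` is `k`-stifled if for every set `S` of at most
`k` coordinates and every target bit `b`, there is an assignment to the coordinates outside `S`
that forces the value of `g` to be `b`. -/
def Stifled {ι : Type} (g : (ι → ZMod 2) → ZMod 2) (k : ℕ) : Prop :=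
  ∀ S : Finset ι, S.card ≤ k → ∀ b : ZMod 2,
    ∃ z : ι → ZMod 2, ∀ x : ι → ZMod 2, (∀ i, i ∉ S → x i = z i) → g x = b

/-- The composed relation `f ∘ g` on inputs split into `n` blocks of coordinates `κ`. -/
def Compose {n : ℕ} {κ R : Type} (f : (Fin n → ZMod 2) → R → Prop)
    (g : (κ → ZMod 2) → ZMod 2) : ((Fin n × κ) → ZMod 2) → R → Prop :=
  fun y r => f (fun i => g fun j => y (i, j)) r

/-- Deterministic decision trees querying single coordinates. -/
inductive DTree (ι R : Type) : Type where
  | leaf (r : R) : DTree ι R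
  | node (i : ι) (t0 t1 : DTree ι R) : DTree ι R

namespace DTree

variable {ι R : Type}

def depth : DTree ι R → ℕ
  | leaf _ => 0
  | node _ t0 t1 => max (depth t0) (depth t1) + 1

def eval : DTree ι R → (ι → ZMod 2) → R
  | leaf r, _ => r
  | node i t0 t1, x => if x i = 1 then eval t1 x else eval t0 x

def Computes (T : DTree ι R) (f : (ι → ZMod 2) → R → Prop) : Prop :=
  ∀ x, f x (T.eval x)

end DTree

/-- Deterministic decision tree complexity: the minimum depth of a decision tree computing `f`. -/
noncomputable def DTdepth {ι R : Type} (f : (ι → ZMod 2) → R → Prop) : ℕ :=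
  sInf {d | ∃ T : DTree ι R, T.Computes f ∧ T.depth = d}

/-- Parity decision trees: each node queries a parity `⟨P, x⟩` over `F₂`. -/
inductive PDTree (ι R : Type) : Type where
  | leaf (r : R) : PDTree ι R
  | node (P : ι → ZMod 2) (t0 t1 : PDTree ι R) : PDTree ι R

namespace PDTree

variable {ι R : Type} [Fintype ι]

def depth {ι R : Type} : PDTree ι R → ℕ
  | leaf _ => 0
  | node _ t0 t1 => max (depth t0) (depth t1) + 1

/-- The number of leaves of a parity decision tree. -/
def size {ι R : Type} : PDTree ι R → ℕ
  | leaf _ => 1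
  | node _ t0 t1 => size t0 + size t1

def eval : PDTree ι R → (ι → ZMod 2) → R
  | leaf r, _ => r
  | node P t0 t1, x => if (∑ i, P i * x i) = 1 then eval t1 x else eval t0 x

def Computes (T : PDTree ι R) (f : (ι → ZMod 2) → R → Prop) : Prop :=
  ∀ x, f x (T.eval x)

end PDTree

/-- Parity decision tree depth complexity. -/
noncomputable def PDTdepth {ι R : Type} [Fintype ι] (f : (ι → ZMod 2) → R → Prop) : ℕ :=
  sInf {d | ∃ T : PDTree ι R, T.Computes f ∧ T.depth = d}

/-- Parity decision tree size complexity: the minimum number of leaves of a PDT computing `f`. -/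
noncomputable def PDTsizeMin {ι R : Type} [Fintype ι] (f : (ι → ZMod 2) → R → Prop) : ℕ :=
  sInf {s | ∃ T : PDTree ι R, T.Computes f ∧ T.size = s}

/-- Subspace decision trees: each node queries membership in an affine subspace of `F₂^ι`. -/
inductive SDTree (ι R : Type) : Type where
  | leaf (r : R) : SDTree ι R
  | node (A : AffineSubspace (ZMod 2) (ι → ZMod 2)) (t0 t1 : SDTree ι R) : SDTree ι R

namespace SDTree

variable {ι R : Type}

def depth : SDTree ι R → ℕ
  | leaf _ => 0
  | node _ t0 t1 => max (depth t0) (depth t1) + 1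

open Classical in
noncomputable def eval : SDTree ι R → (ι → ZMod 2) → R
  | leaf r, _ => r
  | node A t0 t1, x => if x ∈ A then eval t1 x else eval t0 x

def Computes (T : SDTree ι R) (f : (ι → ZMod 2) → R → Prop) : Prop :=
  ∀ x, f x (T.eval x)

end SDTree

/-- Subspace decision tree depth complexity. -/
noncomputable def SDTdepth {ι R : Type} (f : (ι → ZMod 2) → R → Prop) : ℕ :=
  sInf {d | ∃ T : SDTree ι R, T.Computes f ∧ T.depth = d}

/-- A non-adaptive decision tree with `q` queries `qs` (fixed in advance) computes `f`
if the output, a function of the answers only, is always a valid value for `f`. -/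
def NADTComputes {ι R : Type} (q : ℕ) (qs : Fin q → ι)
    (out : (Fin q → ZMod 2) → R) (f : (ι → ZMod 2) → R → Prop) : Prop :=
  ∀ x, f x (out fun t => x (qs t))

/-- Non-adaptive decision tree complexity: the minimum number of (fixed) queries. -/
noncomputable def NADT {ι R : Type} (f : (ι → ZMod 2) → R → Prop) : ℕ :=
  sInf {q | ∃ qs : Fin q → ι, ∃ out : (Fin q → ZMod 2) → R, NADTComputes q qs out f}

/-- A non-adaptive parity decision tree with `q` parity queries `qs` (fixed in advance)
computes `f` if the output, a function of the parity answers only, is always valid for `f`. -/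
def NAPDTComputes {ι R : Type} [Fintype ι] (q : ℕ) (qs : Fin q → ι → ZMod 2)
    (out : (Fin q → ZMod 2) → R) (f : (ι → ZMod 2) → R → Prop) : Prop :=
  ∀ x, f x (out fun t => ∑ i, qs t i * x i)

/-- The number `bin x ∈ [2^m]` represented by the binary expansion `x`. -/
def binIndex {m : ℕ} (x : Fin m → ZMod 2) : Fin (2 ^ m) :=
  finFunctionFinEquiv fun i => (⟨(x i).val, ZMod.val_lt (x i)⟩ : Fin 2)

/-- The Indexing function: `m` addressing variables select one of `2^m` target variables. -/
def IND (m : ℕ) : ((Fin m ⊕ Fin (2 ^ m)) → ZMod 2) → ZMod 2 :=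
  fun w => w (Sum.inr (binIndex fun i => w (Sum.inl i)))

/-- The Inner Product Modulo 2 function on `2m` bits. -/
def IP (m : ℕ) : ((Fin m ⊕ Fin m) → ZMod 2) → ZMod 2 :=
  fun w => ∑ i : Fin m, w (Sum.inl i) * w (Sum.inr i)

/-- The Majority function: `1` iff at least `n/2` of the `n` input bits are `1`. -/
def MAJ (n : ℕ) : (Fin n → ZMod 2) → ZMod 2 :=
  fun x => if n ≤ 2 * (Finset.univ.filter fun i => x i = 1).card then 1 else 0

namespace PDTLift

open Finset

abbrev Vec (n m : ℕ) := (Fin n × Fin m) → ZMod 2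

lemma z2_eq_one {a : ZMod 2} (h : a ≠ 0) : a = 1 := by
  revert a; decide

/-- number of non-free coordinates in block `i` -/
def piv {n m : ℕ} (F : Finset (Fin n × Fin m)) (i : Fin n) : ℕ :=
  (univ.filter fun j : Fin m => (i, j) ∉ F).card

lemma piv_erase_le {n m : ℕ} (F : Finset (Fin n × Fin m)) (p : Fin n × Fin m) :
    piv (F.erase p) p.1 ≤ piv F p.1 + 1 := by
  unfold piv
  refine le_trans (card_le_card (t := insert p.2 (univ.filter fun j : Fin m => (p.1, j) ∉ F)) ?_)
    (card_insert_le _ _)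
  intro j hj
  simp only [mem_filter, mem_univ, true_and, mem_erase, mem_insert] at hj ⊢
  by_contra hc
  push Not at hc
  exact hj ⟨fun h => hc.1 (by rw [← h]), hc.2⟩

lemma piv_erase_ne {n m : ℕ} (F : Finset (Fin n × Fin m)) (p : Fin n × Fin m) (i : Fin n)
    (hi : i ≠ p.1) : piv (F.erase p) i = piv F i := by
  unfold piv
  congr 1
  ext j
  simp only [mem_filter, mem_univ, true_and, mem_erase]
  have : (i, j) ≠ p := fun h => hi (by rw [← h])
  simp [this]

lemma piv_block_ne {n m : ℕ} (F : Finset (Fin n × Fin m)) (i₀ i : Fin n)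
    (hi : i ≠ i₀) : piv (F.filter fun q => q.1 ≠ i₀) i = piv F i := by
  unfold piv
  congr 1
  ext j
  simp [hi]

/-- the invariant of the simulation -/
structure Inv {n m : ℕ} (k : ℕ) (g : (Fin m → ZMod 2) → ZMod 2) (F : Finset (Fin n × Fin m))
    (φ : Vec n m →ᵃ[ZMod 2] Vec n m) (Q : Finset (Fin n)) (ρ : Fin n → ZMod 2) : Prop where
  free : ∀ z, ∀ q ∈ F, φ z q = z q
  dep : ∀ q, q ∉ F → φ.linear (Pi.single q 1) = 0
  val : ∀ z, ∀ i ∈ Q, g (fun j => φ z (i, j)) = ρ i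

noncomputable def dotL {n m : ℕ} (P : Vec n m) : Vec n m →ₗ[ZMod 2] ZMod 2 :=
  ∑ i, P i • LinearMap.proj i

lemma dotL_apply {n m : ℕ} (P y : Vec n m) : dotL P y = ∑ i, P i * y i := by
  simp [dotL]

/-- substitution solving the parity for coordinate `p` -/
noncomputable def solve {n m : ℕ} (L : Vec n m →ᵃ[ZMod 2] ZMod 2) (p : Fin n × Fin m) (b : ZMod 2) :
    Vec n m →ᵃ[ZMod 2] Vec n m :=
  AffineMap.id _ _ + ((LinearMap.toSpanSingleton (ZMod 2) (Vec n m) (Pi.single p 1)).toAffineMap.comp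
    (L + AffineMap.const _ _ b))

lemma solve_apply {n m : ℕ} (L : Vec n m →ᵃ[ZMod 2] ZMod 2) (p : Fin n × Fin m) (b : ZMod 2)
    (z : Vec n m) : solve L p b z = z + (L z + b) • (Pi.single p 1 : Vec n m) := by
  simp [solve, add_smul]

lemma solve_linear {n m : ℕ} (L : Vec n m →ᵃ[ZMod 2] ZMod 2) (p : Fin n × Fin m) (b : ZMod 2)
    (v : Vec n m) : (solve L p b).linear v = v + L.linear v • (Pi.single p 1 : Vec n m) := by
  simp [solve]

/-- substitution fixing block `i` to `w` -/
noncomputable def fixBlock {n m : ℕ} (i : Fin n) (w : Fin m → ZMod 2) :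
    Vec n m →ᵃ[ZMod 2] Vec n m :=
  (LinearMap.pi fun q => if q.1 = i then 0 else LinearMap.proj q :
      Vec n m →ₗ[ZMod 2] Vec n m).toAffineMap +
    AffineMap.const _ _ (fun q => if q.1 = i then w q.2 else 0)

lemma fixBlock_apply {n m : ℕ} (i : Fin n) (w : Fin m → ZMod 2) (z : Vec n m) (q) :
    fixBlock i w z q = if q.1 = i then w q.2 else z q := by
  by_cases h : q.1 = i <;> simp [fixBlock, h]

lemma fixBlock_linear {n m : ℕ} (i : Fin n) (w : Fin m → ZMod 2) (z : Vec n m) (q) :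
    (fixBlock i w).linear z q = if q.1 = i then 0 else z q := by
  by_cases h : q.1 = i <;> simp [fixBlock, h]

lemma inv_solve {n m k : ℕ} {g : (Fin m → ZMod 2) → ZMod 2} {F : Finset (Fin n × Fin m)}
    {φ : Vec n m →ᵃ[ZMod 2] Vec n m} {Q : Finset (Fin n)} {ρ : Fin n → ZMod 2}
    (h : Inv k g F φ Q ρ) (P : Vec n m) (p : Fin n × Fin m) (hp : p ∈ F)
    (hL : ((dotL P).toAffineMap.comp φ).linear (Pi.single p 1) = 1) (b : ZMod 2) :
    Inv k g (F.erase p) (φ.comp (solve ((dotL P).toAffineMap.comp φ) p b)) Q ρ ∧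
    ∀ z, ∑ i, P i * (φ.comp (solve ((dotL P).toAffineMap.comp φ) p b)) z i = b := by
  set L := (dotL P).toAffineMap.comp φ with hLdef
  refine ⟨⟨?_, ?_, ?_⟩, ?_⟩
  · intro z q hq
    rw [mem_erase] at hq
    rw [AffineMap.comp_apply, h.free _ q hq.2, solve_apply]
    simp [hq.1]
  · intro q hq
    rw [AffineMap.comp_linear, LinearMap.comp_apply, solve_linear]
    by_cases hqp : q = p
    · subst hqp
      have h0 : (Pi.single q 1 : Vec n m) + Pi.single q 1 = 0 := by
        funext r
        exact CharTwo.add_self_eq_zero _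
      rw [hL, one_smul, h0, map_zero]
    · have hqF : q ∉ F := fun hh => hq (mem_erase.2 ⟨hqp, hh⟩)
      have : L.linear (Pi.single q 1) = 0 := by
        rw [hLdef, AffineMap.comp_linear, LinearMap.comp_apply, h.dep q hqF, map_zero]
      rw [this, zero_smul, add_zero, h.dep q hqF]
  · intro z i hi
    exact h.val _ i hi
  · intro z
    rw [← dotL_apply]
    have h1 : dotL P (φ.comp (solve L p b) z) = L (solve L p b z) := rfl
    rw [h1, solve_apply]
    have h2 : L (z + (L z + b) • (Pi.single p 1 : Vec n m)) =
        L.linear ((L z + b) • (Pi.single p 1 : Vec n m)) + L z := by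
      rw [add_comm z]
      exact L.map_vadd z _
    rw [h2, map_smul, hL, smul_eq_mul, mul_one]
    have := CharTwo.add_self_eq_zero (L z)
    linear_combination this

lemma inv_fix {n m k : ℕ} {g : (Fin m → ZMod 2) → ZMod 2} {F : Finset (Fin n × Fin m)}
    {φ : Vec n m →ᵃ[ZMod 2] Vec n m} {Q : Finset (Fin n)} {ρ : Fin n → ZMod 2}
    (h : Inv k g F φ Q ρ) (i : Fin n) (hi : i ∉ Q) (b : ZMod 2) (w : Fin m → ZMod 2)
    (hw : ∀ x : Fin m → ZMod 2, (∀ j, (i, j) ∈ F → x j = w j) → g x = b) :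
    Inv k g (F.filter fun q => q.1 ≠ i) (φ.comp (fixBlock i w)) (insert i Q)
      (Function.update ρ i b) := by
  refine ⟨?_, ?_, ?_⟩
  · intro z q hq
    rw [mem_filter] at hq
    rw [AffineMap.comp_apply, h.free _ q hq.1, fixBlock_apply, if_neg hq.2]
  · intro q hq
    rw [AffineMap.comp_linear, LinearMap.comp_apply]
    by_cases hqi : q.1 = i
    · have : (fixBlock i w).linear (Pi.single q 1) = 0 := by
        ext r
        rw [fixBlock_linear]
        split_ifs with hr
        · rfl
        · have : r ≠ q := fun hh => hr (by rw [hh, hqi])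
          simp [this]
      rw [this, map_zero]
    · have : (fixBlock i w).linear (Pi.single q 1) = Pi.single q 1 := by
        ext r
        rw [fixBlock_linear]
        split_ifs with hr
        · have : r ≠ q := fun hh => hqi (by rw [← hh, hr])
          simp [this]
        · rfl
      rw [this]
      exact h.dep q fun hh => hq (mem_filter.2 ⟨hh, hqi⟩)
  · intro z i' hi'
    by_cases hii : i' = i
    · subst hii
      rw [Function.update_self]
      apply hw
      intro j hj
      rw [AffineMap.comp_apply, h.free _ _ hj, fixBlock_apply, if_pos rfl]
    · rw [Function.update_of_ne hii]
      exact h.val _ i' ((mem_insert.1 hi').resolve_left hii)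

lemma main {n m k : ℕ} {R : Type} (g : (Fin m → ZMod 2) → ZMod 2) (hg : Stifled g k)
    (f : (Fin n → ZMod 2) → R → Prop) (T : PDTree (Fin n × Fin m) R) :
    ∀ (F : Finset (Fin n × Fin m)) (φ : Vec n m →ᵃ[ZMod 2] Vec n m) (Q : Finset (Fin n))
      (ρ : Fin n → ZMod 2), Inv k g F φ Q ρ → (∀ i, i ∉ Q → piv F i < k) →
      (∀ z, Compose f g (φ z) (T.eval (φ z))) →
      ∃ D : DTree (Fin n) R, (∀ x, (∀ i ∈ Q, x i = ρ i) → f x (D.eval x)) ∧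
        2 ^ (k * D.depth) ≤ T.size * 2 ^ (∑ i ∈ Qᶜ, piv F i) := by
  induction T with
  | leaf r =>
    intro F φ Q ρ hI hk hT
    refine ⟨.leaf r, ?_, ?_⟩
    · intro x hx
      have hz : ∀ i, ∃ w : Fin m → ZMod 2, i ∉ Q → ∀ y : Fin m → ZMod 2,
          (∀ j, (i, j) ∈ F → y j = w j) → g y = x i := by
        intro i
        by_cases hi : i ∈ Q
        · exact ⟨0, fun h => absurd hi h⟩
        · obtain ⟨w, hw⟩ := hg (univ.filter fun j : Fin m => (i, j) ∉ F) (hk i hi).le (x i)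
          exact ⟨w, fun _ y hy => hw y fun j hj => hy j (by simpa using hj)⟩
      choose w hw using hz
      have h1 := hT (fun q => w q.1 q.2)
      have h2 : (fun i => g fun j => φ (fun q => w q.1 q.2) (i, j)) = x := by
        funext i
        by_cases hi : i ∈ Q
        · rw [hI.val _ i hi, hx i hi]
        · exact hw i hi _ fun j hj => hI.free _ _ hj
      unfold Compose at h1
      rw [h2] at h1
      exact h1
    · simp only [DTree.depth, PDTree.size, mul_zero, pow_zero, one_mul]
      exact Nat.one_le_two_pow
  | node P t0 t1 ih0 ih1 =>
    intro F φ Q ρ hI hk hT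
    by_cases hc : ∃ p ∈ F, ((dotL P).toAffineMap.comp φ).linear (Pi.single p 1) ≠ 0
    · obtain ⟨p, hp, hL⟩ := hc
      have hL := z2_eq_one hL
      -- choose the smaller child
      obtain ⟨b, t, hsz, hev, ih⟩ : ∃ (b : ZMod 2) (t : PDTree (Fin n × Fin m) R),
          2 * t.size ≤ (PDTree.node P t0 t1).size ∧
          (∀ y : Vec n m, ∑ i, P i * y i = b → (PDTree.node P t0 t1).eval y = t.eval y) ∧
          (∀ (F : Finset (Fin n × Fin m)) (φ : Vec n m →ᵃ[ZMod 2] Vec n m) (Q : Finset (Fin n))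
            (ρ : Fin n → ZMod 2), Inv k g F φ Q ρ → (∀ i, i ∉ Q → piv F i < k) →
            (∀ z, Compose f g (φ z) (t.eval (φ z))) →
            ∃ D : DTree (Fin n) R, (∀ x, (∀ i ∈ Q, x i = ρ i) → f x (D.eval x)) ∧
              2 ^ (k * D.depth) ≤ t.size * 2 ^ (∑ i ∈ Qᶜ, piv F i)) := by
        rcases le_total t0.size t1.size with hle | hle
        · refine ⟨0, t0, by simp only [PDTree.size]; omega, ?_, ih0⟩
          intro y hy
          simp [PDTree.eval, hy]
        · refine ⟨1, t1, by simp only [PDTree.size]; omega, ?_, ih1⟩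
          intro y hy
          simp [PDTree.eval, hy]
      obtain ⟨hI', hb⟩ := inv_solve hI P p hp hL b
      set φ' := φ.comp (solve ((dotL P).toAffineMap.comp φ) p b) with hφ'
      have hT' : ∀ z, Compose f g (φ' z) (t.eval (φ' z)) := by
        intro z
        rw [← hev _ (hb z)]
        exact hT _
      have hne : ∀ i, i ≠ p.1 → piv (F.erase p) i = piv F i := piv_erase_ne F p
      have hle := piv_erase_le F p
      by_cases hcase : p.1 ∈ Q ∨ piv (F.erase p) p.1 < k
      · obtain ⟨D, hD, hs⟩ := ih _ φ' Q ρ hI' (by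
          intro i hi
          by_cases hip : i = p.1
          · subst hip; exact hcase.resolve_left hi
          · rw [hne i hip]; exact hk i hi) hT'
        refine ⟨D, hD, hs.trans ?_⟩
        have hsum : ∑ i ∈ Qᶜ, piv (F.erase p) i ≤ ∑ i ∈ Qᶜ, piv F i + 1 := by
          calc ∑ i ∈ Qᶜ, piv (F.erase p) i
              ≤ ∑ i ∈ Qᶜ, (piv F i + if i = p.1 then 1 else 0) := by
                refine sum_le_sum fun i _ => ?_
                by_cases hip : i = p.1
                · subst hip; simpa using hle
                · simp [hip, hne i hip]
            _ ≤ _ := by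
                rw [sum_add_distrib, sum_ite_eq']
                split_ifs <;> omega
        calc t.size * 2 ^ (∑ i ∈ Qᶜ, piv (F.erase p) i)
            ≤ t.size * 2 ^ (∑ i ∈ Qᶜ, piv F i + 1) := by
              gcongr; norm_num
          _ = (2 * t.size) * 2 ^ (∑ i ∈ Qᶜ, piv F i) := by ring
          _ ≤ _ := by gcongr
      · push Not at hcase
        obtain ⟨hpQ, hpk⟩ := hcase
        have hpk' := hk p.1 hpQ
        have key : ∀ c : ZMod 2, ∃ D : DTree (Fin n) R,
            (∀ x, (∀ i ∈ Q, x i = ρ i) → x p.1 = c → f x (D.eval x)) ∧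
            2 ^ (k * D.depth) ≤ t.size * 2 ^ (∑ i ∈ (insert p.1 Q)ᶜ, piv F i) := by
          intro c
          obtain ⟨w, hw⟩ := hg (univ.filter fun j : Fin m => (p.1, j) ∉ F.erase p)
            (by change piv (F.erase p) p.1 ≤ k; omega) c
          have hI2 := inv_fix hI' p.1 hpQ c w (fun y hy => hw y fun j hj => hy j (by
            by_contra hh
            exact hj (mem_filter.2 ⟨mem_univ _, hh⟩)))
          have hpv : ∀ i, i ∉ insert p.1 Q →
              piv ((F.erase p).filter fun q => q.1 ≠ p.1) i = piv F i := by
            intro i hi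
            have hip : i ≠ p.1 := fun hh => hi (by simp [hh])
            rw [piv_block_ne _ _ _ hip, hne i hip]
          obtain ⟨D, hD, hs⟩ := ih _ _ _ _ hI2 (by
            intro i hi
            rw [hpv i hi]
            exact hk i fun hh => hi (mem_insert_of_mem hh)) (fun z => hT' _)
          refine ⟨D, ?_, ?_⟩
          · intro x hx hxc
            apply hD
            intro i hi
            by_cases hip : i = p.1
            · subst hip; simpa using hxc
            · rw [Function.update_of_ne hip]
              exact hx i ((mem_insert.1 hi).resolve_left hip)
          · rwa [sum_congr rfl (fun i hi => hpv i (mem_compl.1 hi))] at hs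
        obtain ⟨D0, hD0, hs0⟩ := key 0
        obtain ⟨D1, hD1, hs1⟩ := key 1
        refine ⟨.node p.1 D0 D1, ?_, ?_⟩
        · intro x hx
          by_cases hx1 : x p.1 = 1
          · simp only [DTree.eval, hx1, if_true]
            exact hD1 x hx hx1
          · simp only [DTree.eval, hx1, if_false]
            refine hD0 x hx ?_
            by_contra h0
            exact hx1 (z2_eq_one h0)
        · have hmax : 2 ^ (k * max D0.depth D1.depth) ≤
              t.size * 2 ^ (∑ i ∈ (insert p.1 Q)ᶜ, piv F i) := by
            rcases max_cases D0.depth D1.depth with h | h <;> rw [h.1] <;> assumption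
          have hsum : ∑ i ∈ Qᶜ, piv F i = piv F p.1 + ∑ i ∈ (insert p.1 Q)ᶜ, piv F i := by
            rw [compl_insert, add_sum_erase _ _ (mem_compl.2 hpQ)]
          have hkk : k = piv F p.1 + 1 := by omega
          rw [hsum]
          generalize ∑ i ∈ (insert p.1 Q)ᶜ, piv F i = s at hmax ⊢
          calc 2 ^ (k * (max D0.depth D1.depth + 1))
              = 2 ^ (k * max D0.depth D1.depth) * 2 ^ k := by ring
            _ ≤ t.size * 2 ^ s * 2 ^ k := by gcongr
            _ = t.size * 2 ^ s * 2 ^ (piv F p.1 + 1) := by rw [← hkk]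
            _ = (2 * t.size) * 2 ^ (piv F p.1 + s) := by ring
            _ ≤ _ := by gcongr
    · push Not at hc
      have hlin : ((dotL P).toAffineMap.comp φ).linear = 0 := by
        refine LinearMap.pi_ext' fun q => LinearMap.ext_ring ?_
        simp only [LinearMap.comp_apply, LinearMap.coe_single, LinearMap.zero_apply]
        by_cases hq : q ∈ F
        · exact hc q hq
        · rw [AffineMap.comp_linear, LinearMap.comp_apply, hI.dep q hq, map_zero]
      have hconst : ∀ z, ∑ i, P i * φ z i = ∑ i, P i * φ 0 i := by
        intro z
        rw [← dotL_apply, ← dotL_apply]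
        have := ((dotL P).toAffineMap.comp φ).map_vadd 0 z
        rw [hlin] at this
        simpa using this
      by_cases h1 : ∑ i, P i * φ 0 i = 1
      · obtain ⟨D, hD, hs⟩ := ih1 F φ Q ρ hI hk (by
          intro z
          have := hT z
          simpa only [PDTree.eval, hconst z, h1, if_true] using this)
        refine ⟨D, hD, hs.trans ?_⟩
        gcongr
        simp only [PDTree.size]; omega
      · obtain ⟨D, hD, hs⟩ := ih0 F φ Q ρ hI hk (by
          intro z
          have := hT z
          simpa only [PDTree.eval, hconst z, h1, if_false] using this)
        refine ⟨D, hD, hs.trans ?_⟩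
        gcongr
        simp only [PDTree.size]; omega

end PDTLift

/-- If `g` is `k`-stifled (`k ≥ 1`), then every parity decision tree computing
the composed relation `f ∘ g` has at least `2^(DT(f)·k)` leaves, i.e.
`PDTsize(f ∘ g) ≥ 2^(DT(f)·k)`. -/
theorem pdt_size_lifting {n m k : ℕ} {R : Type} (hk : 1 ≤ k)
    (g : (Fin m → ZMod 2) → ZMod 2) (hg : Stifled g k)
    (f : (Fin n → ZMod 2) → R → Prop) :
    ∀ T : PDTree (Fin n × Fin m) R, T.Computes (Compose f g) →
      2 ^ (DTdepth f * k) ≤ T.size := by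
  intro T hT
  have hpiv : ∀ i : Fin n, PDTLift.piv (Finset.univ : Finset (Fin n × Fin m)) i = 0 := by
    intro i
    simp [PDTLift.piv]
  obtain ⟨D, hD, hs⟩ := PDTLift.main g hg f T Finset.univ (AffineMap.id _ _) ∅ 0
    ⟨fun _ _ _ => rfl, fun q hq => absurd (Finset.mem_univ q) hq,
      fun _ i hi => absurd hi (Finset.notMem_empty i)⟩
    (fun i _ => by rw [hpiv i]; omega) (fun z => hT z)
  have hd : DTdepth f ≤ D.depth := Nat.sInf_le ⟨D, fun x => hD x (by simp), rfl⟩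
  simp only [hpiv, Finset.sum_const_zero, pow_zero, mul_one] at hs
  refine le_trans ?_ hs
  rw [mul_comm]
  gcongr
  norm_num
end

section
/- Let g : {0,1}^m → {0,1} be a k-stifled Boolean function (with k ≥ 1) and let f ⊆ {0,1}^n × R be a relation. Then sDT(f ∘ g) ≥ DT(f)·k, i.e., every subspace decision tree computing f ∘ g has depth at least DT(f)·k. -/
/-- affine self-maps of a function space over `F₂`. -/
def IsAff {ι : Type} (φ : (ι → ZMod 2) → (ι → ZMod 2)) : Prop :=
  ∃ (L : (ι → ZMod 2) →ₗ[ZMod 2] (ι → ZMod 2)) (a : ι → ZMod 2), ∀ y, φ y = L y + a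

theorem IsAff.comp {ι : Type} {φ ψ : (ι → ZMod 2) → (ι → ZMod 2)}
    (h1 : IsAff φ) (h2 : IsAff ψ) : IsAff (fun y => φ (ψ y)) := by
  obtain ⟨L, a, hL⟩ := h1
  obtain ⟨M, b, hM⟩ := h2
  refine ⟨L ∘ₗ M, L b + a, fun y => ?_⟩
  simp [hL, hM, add_assoc]

theorem isAff_restrict {ι : Type} (P : ι → Prop) [DecidablePred P] (z : ι → ZMod 2) :
    IsAff (fun y c => if P c then z c else y c) := by
  refine ⟨LinearMap.pi fun c => if P c then 0 else LinearMap.proj c,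
    fun c => if P c then z c else 0, fun y => ?_⟩
  funext c
  by_cases h : P c <;> simp [h]

theorem aff_step {ι : Type} [Fintype ι] [DecidableEq ι]
    (φ : (ι → ZMod 2) → (ι → ZMod 2)) (hφ : IsAff φ) (F : Finset ι)
    (hF2 : ∀ y y', (∀ c ∈ F, y c = y' c) → φ y = φ y')
    (A : AffineSubspace (ZMod 2) (ι → ZMod 2)) (h1 : ∃ y, φ y ∈ A) (h2 : ∃ y, φ y ∉ A) :
    ∃ c ∈ F, ∃ ψ, IsAff ψ ∧ (∀ y, φ (ψ y) ∉ A) ∧ (∀ y, ∀ d, d ≠ c → ψ y d = y d) ∧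
      (∀ y y', (∀ d ∈ F.erase c, y d = y' d) → ∀ d ∈ F, ψ y d = ψ y' d) := by
  obtain ⟨L, a, hL⟩ := hφ
  obtain ⟨y0, h1⟩ := h1
  obtain ⟨y1, h2⟩ := h2
  have hd : φ y1 - φ y0 ∉ A.direction := by
    intro h
    have := AffineSubspace.vadd_mem_of_mem_direction h h1
    simp at this
    exact h2 this
  obtain ⟨u, hu, hA⟩ := Submodule.exists_le_ker_of_notMem hd
  have hz2 : ∀ x : ZMod 2, x ≠ 0 → x = 1 := by decide
  have hex : ∃ c, u (L (Pi.single c 1)) ≠ 0 := by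
    by_contra hno
    push Not at hno
    have : u ∘ₗ L = 0 := by
      apply LinearMap.pi_ext'
      intro c
      apply LinearMap.ext_ring
      simpa using hno c
    apply hu
    have h3 : φ y1 - φ y0 = L (y1 - y0) := by simp [hL]
    rw [h3]
    exact LinearMap.congr_fun this _
  obtain ⟨c, hc⟩ := hex
  have hc1 := hz2 _ hc
  have hcF : c ∈ F := by
    by_contra hcF
    apply hc
    have h4 : φ (Pi.single c 1) = φ 0 := by
      apply hF2
      intro d hd
      have : d ≠ c := by rintro rfl; exact hcF hd
      simp [this]
    have h5 : L (Pi.single c 1) = 0 := by simpa [hL] using h4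
    simp [h5]
  have hshift : ∀ y t, u (φ (y + t • Pi.single c 1)) = u (φ y) + t := by
    intro y t
    rw [hL, hL]
    simp only [map_add, map_smul, hc1, smul_eq_mul, mul_one]
    ring
  have key : ∀ p t : ZMod 2, p + (p - t + 1) - t ≠ 0 := by decide
  refine ⟨c, hcF, fun y => y + (u (φ y) - u (φ y0) + 1) • Pi.single c 1, ?_, ?_, ?_, ?_⟩
  · refine ⟨LinearMap.id + (u ∘ₗ L).smulRight (Pi.single c 1),
      (u a - u (φ y0) + 1) • Pi.single c 1, fun y => ?_⟩
    simp only [hL, LinearMap.add_apply, LinearMap.id_apply, LinearMap.smulRight_apply,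
      LinearMap.comp_apply, map_add]
    module
  · intro y hy
    have h6 : φ (y + (u (φ y) - u (φ y0) + 1) • Pi.single c 1) - φ y0 ∈ A.direction :=
      AffineSubspace.vsub_mem_direction hy h1
    have h7 := hA h6
    rw [LinearMap.mem_ker, map_sub, hshift] at h7
    exact key _ _ h7
  · intro y d hd
    simp [hd]
  · intro y y' h d hdF
    by_cases hdc : d = c
    · subst hdc
      have h8 : φ y' = φ (y + (y' d - y d) • Pi.single d 1) := by
        apply hF2
        intro e he
        by_cases hed : e = d
        · subst hed; simp
        · simp [hed, h e (Finset.mem_erase.2 ⟨hed, he⟩)]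
      have h9 : u (φ y') = u (φ y) + (y' d - y d) := by rw [h8, hshift]
      have : ∀ p q r s : ZMod 2, p + (r - s + 1) = q + (r + (q - p) - s + 1) := by decide
      simp [h9]
      exact this _ _ _ _
    · simp [hdc, h d (Finset.mem_erase.2 ⟨hdc, hdF⟩)]

/-- non-free coordinates in block `i`. -/
def missing {n m : ℕ} (F : Finset (Fin n × Fin m)) (i : Fin n) : Finset (Fin m) :=
  Finset.univ.filter fun j => (i, j) ∉ F

theorem lift_aux {n m k : ℕ} {R : Type}
    (g : (Fin m → ZMod 2) → ZMod 2) (hg : Stifled g k)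
    (f : (Fin n → ZMod 2) → R → Prop) (T : SDTree (Fin n × Fin m) R) :
    ∀ (φ : ((Fin n × Fin m) → ZMod 2) → ((Fin n × Fin m) → ZMod 2)) (Q : Finset (Fin n))
      (z0 : Fin n → ZMod 2) (F : Finset (Fin n × Fin m)),
      IsAff φ → (∀ y, ∀ c ∈ F, φ y c = y c) →
      (∀ y y', (∀ c ∈ F, y c = y' c) → φ y = φ y') →
      (∀ c ∈ F, c.1 ∈ Q) →
      (∀ i, i ∉ Q → ∀ y, g (fun j => φ y (i, j)) = z0 i) →
      (∀ i ∈ Q, (missing F i).card < k) →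
      (∀ y, Compose f g (φ y) (T.eval (φ y))) →
      ∃ D : DTree (Fin n) R, (∀ x, (∀ i, i ∉ Q → x i = z0 i) → f x (D.eval x)) ∧
        D.depth * k ≤ T.depth + ∑ i ∈ Q, (missing F i).card := by
  classical
  induction T with
  | leaf r =>
    intro φ Q z0 F hφ hF1 hF2 hFQ hdead hlive hT
    refine ⟨DTree.leaf r, fun x hx => ?_, by simp [DTree.depth]⟩
    have hz : ∀ i, ∃ z : Fin m → ZMod 2, i ∈ Q →
        ∀ w : Fin m → ZMod 2, (∀ j, j ∉ missing F i → w j = z j) → g w = x i := by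
      intro i
      by_cases hi : i ∈ Q
      · obtain ⟨z, hz⟩ := hg (missing F i) (hlive i hi).le (x i)
        exact ⟨z, fun _ => hz⟩
      · exact ⟨0, fun h => absurd h hi⟩
    choose z hz using hz
    have h := hT (fun c => z c.1 c.2)
    have hx' : (fun i => g fun j => φ (fun c => z c.1 c.2) (i, j)) = x := by
      funext i
      by_cases hi : i ∈ Q
      · apply hz i hi
        intro j hj
        have hj' : (i, j) ∈ F := by simpa [missing] using hj
        rw [hF1 _ _ hj']
      · rw [hdead i hi, hx i hi]
    unfold Compose at h
    rw [hx'] at h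
    exact h
  | node A t0 t1 ih0 ih1 =>
    intro φ Q z0 F hφ hF1 hF2 hFQ hdead hlive hT
    by_cases h2 : ∃ y, φ y ∉ A
    swap
    · push Not at h2
      obtain ⟨D, hD, hd⟩ := ih1 φ Q z0 F hφ hF1 hF2 hFQ hdead hlive (fun y => by
        have := hT y
        rwa [SDTree.eval, if_pos (h2 y)] at this)
      refine ⟨D, hD, hd.trans ?_⟩
      simp only [SDTree.depth]
      have := le_max_right t0.depth t1.depth
      omega
    by_cases h1 : ∃ y, φ y ∈ A
    swap
    · push Not at h1
      obtain ⟨D, hD, hd⟩ := ih0 φ Q z0 F hφ hF1 hF2 hFQ hdead hlive (fun y => by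
        have := hT y
        rwa [SDTree.eval, if_neg (h1 y)] at this)
      refine ⟨D, hD, hd.trans ?_⟩
      simp only [SDTree.depth]
      have := le_max_left t0.depth t1.depth
      omega
    obtain ⟨c, hcF, ψ, hψ, hψA, hψd, hψF⟩ := aff_step φ hφ F hF2 A h1 h2
    obtain ⟨i, j⟩ := c
    have hiQ : i ∈ Q := hFQ _ hcF
    set F' := F.erase (i, j) with hF'
    have hF1' : ∀ y, ∀ d ∈ F', φ (ψ y) d = y d := by
      intro y d hd
      rw [hF', Finset.mem_erase] at hd
      rw [hF1 _ _ hd.2, hψd _ _ hd.1]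
    have hF2' : ∀ y y', (∀ d ∈ F', y d = y' d) → φ (ψ y) = φ (ψ y') :=
      fun y y' h => hF2 _ _ (hψF y y' h)
    have hT' : ∀ y, Compose f g (φ (ψ y)) (t0.eval (φ (ψ y))) := by
      intro y
      have := hT (ψ y)
      rwa [SDTree.eval, if_neg (hψA y)] at this
    have hmi : (missing F' i).card = (missing F i).card + 1 := by
      have : missing F' i = insert j (missing F i) := by
        ext l
        by_cases hl : l = j <;> simp [missing, hF', hl]
      rw [this, Finset.card_insert_of_notMem]
      simp [missing, hcF]
    have hmo : ∀ l, l ≠ i → missing F' l = missing F l := by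
      intro l hl
      ext s
      simp [missing, hF', hl]
    have hsum : ∑ l ∈ Q.erase i, (missing F' l).card = ∑ l ∈ Q.erase i, (missing F l).card :=
      Finset.sum_congr rfl fun l hl => by rw [hmo l (Finset.ne_of_mem_erase hl)]
    have hs1 := Finset.add_sum_erase Q (fun l => (missing F l).card) hiQ
    have hs2 := Finset.add_sum_erase Q (fun l => (missing F' l).card) hiQ
    have hmax := le_max_left t0.depth t1.depth
    have hlt := hlive i hiQ
    by_cases hk : (missing F' i).card < k
    · obtain ⟨D, hD, hd⟩ := ih0 (fun y => φ (ψ y)) Q z0 F' (hφ.comp hψ) hF1' hF2'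
        (fun d hd => hFQ d (Finset.mem_of_mem_erase hd)) (fun l hl y => hdead l hl (ψ y))
        (fun l hl => by
          by_cases hli : l = i
          · rw [hli]; exact hk
          · rw [hmo l hli]; exact hlive l hl) hT'
      refine ⟨D, hD, hd.trans ?_⟩
      simp only [SDTree.depth]
      omega
    · have hb : ∀ b : ZMod 2, ∃ D : DTree (Fin n) R,
          (∀ x, (∀ l, l ∉ Q → x l = z0 l) → x i = b → f x (D.eval x)) ∧
          D.depth * k ≤ t0.depth + ∑ l ∈ Q.erase i, (missing F l).card := by
        intro b
        obtain ⟨z, hz⟩ := hg (missing F' i) (by omega) b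
        have hmo2 : ∀ l, l ≠ i → missing (F'.filter fun d => d.1 ≠ i) l = missing F l := by
          intro l hl
          ext s
          simp [missing, hF', hl]
        obtain ⟨D, hD, hd⟩ := ih0
          (fun y => φ (ψ (fun d => if d.1 = i then z d.2 else y d)))
          (Q.erase i) (Function.update z0 i b) (F'.filter fun d => d.1 ≠ i)
          ((hφ.comp hψ).comp (isAff_restrict (fun d : Fin n × Fin m => d.1 = i) (fun d => z d.2)))
          (fun y d hd => by
            rw [Finset.mem_filter] at hd
            rw [hF1' _ _ hd.1, if_neg hd.2])
          (fun y y' h => by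
            apply hF2'
            intro d hd
            by_cases hdi : d.1 = i
            · simp [hdi]
            · simp only [hdi, if_false]
              exact h d (Finset.mem_filter.2 ⟨hd, hdi⟩))
          (fun d hd => by
            rw [Finset.mem_filter] at hd
            exact Finset.mem_erase.2 ⟨hd.2, hFQ d (Finset.mem_of_mem_erase hd.1)⟩)
          (fun l hl y => by
            by_cases hli : l = i
            · subst hli
              rw [Function.update_self]
              apply hz
              intro s hs
              have hs' : (l, s) ∈ F' := by simpa [missing] using hs
              rw [hF1' _ _ hs']
              simp
            · rw [Function.update_of_ne hli]
              exact hdead l (fun h => hl (Finset.mem_erase.2 ⟨hli, h⟩)) _)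
          (fun l hl => by
            rw [Finset.mem_erase] at hl
            rw [hmo2 l hl.1]
            exact hlive l hl.2)
          (fun y => hT' _)
        refine ⟨D, fun x hx hxi => hD x fun l hl => ?_, hd.trans ?_⟩
        · by_cases hli : l = i
          · subst hli
            simpa using hxi
          · rw [Function.update_of_ne hli]
            exact hx l fun h => hl (Finset.mem_erase.2 ⟨hli, h⟩)
        · apply le_of_eq
          congr 1
          exact Finset.sum_congr rfl fun l hl => by rw [hmo2 l (Finset.ne_of_mem_erase hl)]
      obtain ⟨D0, hD0, hd0⟩ := hb 0
      obtain ⟨D1, hD1, hd1⟩ := hb 1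
      refine ⟨DTree.node i D0 D1, fun x hx => ?_, ?_⟩
      · rw [DTree.eval]
        split_ifs with hxi
        · exact hD1 x hx hxi
        · have hz2 : ∀ x : ZMod 2, x ≠ 1 → x = 0 := by decide
          exact hD0 x hx (hz2 _ hxi)
      · simp only [SDTree.depth, DTree.depth]
        have hm : max D0.depth D1.depth * k ≤ t0.depth + ∑ l ∈ Q.erase i, (missing F l).card := by
          rcases max_choice D0.depth D1.depth with h | h <;> rw [h] <;> assumption
        rw [add_mul]
        omega

/-- If `g` is `k`-stifled (`k ≥ 1`), then every subspace decision tree computing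
the composed relation `f ∘ g` has depth at least `DT(f)·k`, i.e. `sDT(f ∘ g) ≥ DT(f)·k`. -/
theorem sdt_depth_lifting {n m k : ℕ} {R : Type} (hk : 1 ≤ k)
    (g : (Fin m → ZMod 2) → ZMod 2) (hg : Stifled g k)
    (f : (Fin n → ZMod 2) → R → Prop) :
    ∀ T : SDTree (Fin n × Fin m) R, T.Computes (Compose f g) →
      DTdepth f * k ≤ T.depth := by
  intro T hT
  have hmiss : ∀ i : Fin n, (missing (Finset.univ : Finset (Fin n × Fin m)) i).card = 0 := by
    intro i
    simp [missing]
  obtain ⟨D, hD, hd⟩ := lift_aux g hg f T (fun y => y) Finset.univ 0 Finset.univ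
    ⟨LinearMap.id, 0, fun y => by simp⟩ (fun y c _ => rfl)
    (fun y y' h => funext fun c => h c (Finset.mem_univ c)) (fun c _ => Finset.mem_univ _)
    (fun i hi => absurd (Finset.mem_univ i) hi) (fun i _ => by rw [hmiss]; exact hk) hT
  have h1 : DTdepth f ≤ D.depth :=
    Nat.sInf_le ⟨D, fun x => hD x fun i hi => absurd (Finset.mem_univ i) hi, rfl⟩
  calc DTdepth f * k ≤ D.depth * k := Nat.mul_le_mul_right k h1
    _ ≤ T.depth := by simpa [hmiss] using hd
end

section
/- Let g : {0,1}^m → {0,1} be a k-stifled Boolean function (with k ≥ 1) and let f ⊆ {0,1}^n × R be a relation. Then PDT(f ∘ g) ≥ DT(f)·k, i.e., every parity decision tree computing f ∘ g has depth at least DT(f)·k. -/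
/-- Affine maps over `F₂`, described by compatibility with sums of three points. -/
def Aff3 {V W : Type} [Add V] [Add W] (h : V → W) : Prop :=
  ∀ a b c, h (a + b + c) = h a + h b + h c

/-- Coordinates of block `i` outside the free set `F`. -/
def deadSet {n m : ℕ} (F : Finset (Fin n × Fin m)) (i : Fin n) : Finset (Fin m) :=
  Finset.univ.filter fun j => (i, j) ∉ F

lemma zmod2_cases (a : ZMod 2) : a = 0 ∨ a = 1 := by
  revert a; decide

lemma zmod2_add_self (a : ZMod 2) : a + a = 0 := by
  revert a; decide

lemma aff3_const {ι : Type} [Fintype ι] [DecidableEq ι] (l : (ι → ZMod 2) → ZMod 2)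
    (hl : Aff3 l) (h : ∀ p, l (Pi.single p 1) = l 0) (y : ι → ZMod 2) : l y = l 0 := by
  let φ : (ι → ZMod 2) →+ ZMod 2 :=
    { toFun := fun y => l y + l 0
      map_zero' := zmod2_add_self _
      map_add' := by
        intro a b
        have h1 := hl a b 0
        rw [add_zero] at h1
        rw [h1]
        ring }
  have hφ : φ = 0 := by
    apply AddMonoidHom.functions_ext
    intro i x
    rcases zmod2_cases x with rfl | rfl
    · simp
    · change l (Pi.single i 1) + l 0 = 0
      rw [h i, zmod2_add_self]
  have h2 : l y + l 0 = 0 := DFunLike.congr_fun hφ y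
  have key : ∀ a b : ZMod 2, a + b = 0 → a = b := by decide
  exact key _ _ h2

lemma aff3_flip {ι : Type} [DecidableEq ι] (l : (ι → ZMod 2) → ZMod 2)
    (hl : Aff3 l) (p : ι) (h : l (Pi.single p 1) ≠ l 0) (y : ι → ZMod 2) (c : ZMod 2) :
    l (y + Pi.single p c) = l y + c := by
  have h1 := hl y (Pi.single p 1) 0
  rw [add_zero] at h1
  rcases zmod2_cases c with rfl | rfl
  · simp
  · rw [h1]
    have key : ∀ a b c : ZMod 2, a ≠ b → c + a + b = c + 1 := by decide
    exact key _ _ _ h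

/-- Invariant of the simulation. -/
structure Good {n m : ℕ} (g : (Fin m → ZMod 2) → ZMod 2) (k : ℕ)
    (Φ : (Fin n × Fin m → ZMod 2) → (Fin n × Fin m → ZMod 2))
    (F : Finset (Fin n × Fin m)) (Q : Finset (Fin n)) (x0 : Fin n → ZMod 2) : Prop where
  aff : Aff3 Φ
  free : ∀ p ∈ F, ∀ y, Φ y p = y p
  dep : ∀ y y', (∀ p ∈ F, y p = y' p) → Φ y = Φ y'
  val : ∀ i ∈ Q, ∀ y, g (fun j => Φ y (i, j)) = x0 i
  dead : ∀ i ∈ Q, ∀ j, (i, j) ∉ F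
  small : ∀ i, i ∉ Q → (deadSet F i).card ≤ k

lemma deadSet_erase_ne {n m : ℕ} (F : Finset (Fin n × Fin m)) (p : Fin n × Fin m) (i : Fin n)
    (h : i ≠ p.1) : deadSet (F.erase p) i = deadSet F i := by
  ext j
  simp only [deadSet, Finset.mem_filter, Finset.mem_univ, true_and, Finset.mem_erase]
  have : (i, j) ≠ p := fun e => h (by rw [← e])
  tauto

lemma deadSet_erase_self {n m : ℕ} (F : Finset (Fin n × Fin m)) (p : Fin n × Fin m)
    (hp : p ∈ F) : (deadSet (F.erase p) p.1).card = (deadSet F p.1).card + 1 := by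
  have : deadSet (F.erase p) p.1 = insert p.2 (deadSet F p.1) := by
    ext j
    simp only [deadSet, Finset.mem_filter, Finset.mem_univ, true_and, Finset.mem_erase,
      Finset.mem_insert]
    have : (p.1, j) = p ↔ j = p.2 := by
      constructor
      · intro e; rw [← e]
      · rintro rfl; rfl
    tauto
  rw [this, Finset.card_insert_of_notMem]
  simpa [deadSet] using hp

lemma good_erase {n m k : ℕ} {g : (Fin m → ZMod 2) → ZMod 2}
    {Φ : (Fin n × Fin m → ZMod 2) → (Fin n × Fin m → ZMod 2)}
    {F : Finset (Fin n × Fin m)} {Q : Finset (Fin n)} {x0 : Fin n → ZMod 2}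
    (G : Good g k Φ F Q x0) (hlt : ∀ i, i ∉ Q → (deadSet F i).card < k)
    (l : (Fin n × Fin m → ZMod 2) → ZMod 2) (hl : Aff3 l)
    (hdep : ∀ y y', (∀ p ∈ F, y p = y' p) → l y = l y')
    (p : Fin n × Fin m) (hp : p ∈ F) (h : l (Pi.single p 1) ≠ l 0) :
    Good g k (fun y => Φ (y + Pi.single p (l y))) (F.erase p) Q x0 where
  aff := by
    intro a b c
    simp only
    rw [← G.aff, hl, Pi.single_add, Pi.single_add]
    congr 1
    abel
  free := by
    intro q hq y
    rw [Finset.mem_erase] at hq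
    rw [G.free q hq.2]
    simp [Pi.single_apply, hq.1]
  dep := by
    intro y y' hyy
    apply G.dep
    have h1 : l (y + Pi.single p (y p + y' p)) = l y' := by
      apply hdep
      intro q hq
      by_cases e : q = p
      · subst e
        simp [← add_assoc, zmod2_add_self]
      · simp [Pi.single_apply, e, hyy q (Finset.mem_erase.2 ⟨e, hq⟩)]
    rw [aff3_flip l hl p h] at h1
    intro q hq
    by_cases e : q = p
    · subst e
      simp only [Pi.add_apply, Pi.single_eq_same, ← h1]
      have key : ∀ a b c : ZMod 2, a + b = c + (b + (a + c)) := by decide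
      exact key _ _ _
    · simp [Pi.single_apply, e, hyy q (Finset.mem_erase.2 ⟨e, hq⟩)]
  val := fun i hi y => G.val i hi _
  dead := fun i hi j hj => G.dead i hi j (Finset.mem_of_mem_erase hj)
  small := by
    intro i hi
    by_cases e : i = p.1
    · subst e
      rw [deadSet_erase_self F p hp]
      exact hlt _ hi
    · rw [deadSet_erase_ne F p i e]
      exact (hlt i hi).le

/-- Overwrite block `i` by `z`. -/
def setBlock {n m : ℕ} (i : Fin n) (z : Fin m → ZMod 2) (y : Fin n × Fin m → ZMod 2) :
    Fin n × Fin m → ZMod 2 := fun q => if q.1 = i then z q.2 else y q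

lemma good_block {n m k : ℕ} {g : (Fin m → ZMod 2) → ZMod 2}
    {Φ : (Fin n × Fin m → ZMod 2) → (Fin n × Fin m → ZMod 2)}
    {F : Finset (Fin n × Fin m)} {Q : Finset (Fin n)} {x0 : Fin n → ZMod 2}
    (G : Good g k Φ F Q x0) (i : Fin n) (hi : i ∉ Q) (b : ZMod 2) (z : Fin m → ZMod 2)
    (hz : ∀ x : Fin m → ZMod 2, (∀ j, j ∉ deadSet F i → x j = z j) → g x = b) :
    Good g k (fun y => Φ (setBlock i z y)) (F.filter fun q => q.1 ≠ i) (insert i Q)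
      (Function.update x0 i b) where
  aff := by
    intro a b c
    simp only
    rw [← G.aff]
    congr 1
    ext q
    simp only [setBlock, Pi.add_apply]
    split_ifs
    · rw [zmod2_add_self, zero_add]
    · rfl
  free := by
    intro q hq y
    rw [Finset.mem_filter] at hq
    rw [G.free q hq.1]
    simp [setBlock, hq.2]
  dep := by
    intro y y' hyy
    apply G.dep
    intro q hq
    simp only [setBlock]
    split_ifs with e
    · rfl
    · exact hyy q (Finset.mem_filter.2 ⟨hq, e⟩)
  val := by
    intro i' hi' y
    by_cases e : i' = i
    · subst e
      rw [Function.update_self]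
      apply hz
      intro j hj
      have hj' : (i', j) ∈ F := by simpa [deadSet] using hj
      rw [G.free _ hj']
      simp [setBlock]
    · rw [Function.update_of_ne e]
      exact G.val i' ((Finset.mem_insert.1 hi').resolve_left e) _
  dead := by
    intro i' hi' j hj
    rw [Finset.mem_filter] at hj
    exact G.dead i' ((Finset.mem_insert.1 hi').resolve_left hj.2) j hj.1
  small := by
    intro i' hi'
    rw [Finset.mem_insert, not_or] at hi'
    have : deadSet (F.filter fun q => q.1 ≠ i) i' = deadSet F i' := by
      ext j
      simp [deadSet, hi'.1]
    rw [this]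
    exact G.small i' hi'.2

lemma aff3_parity {ι κ : Type} [Fintype ι] (P : ι → ZMod 2) (Φ : (κ → ZMod 2) → (ι → ZMod 2))
    (h : Aff3 Φ) : Aff3 fun y => ∑ q, P q * Φ y q := by
  intro a b c
  simp only
  rw [h, ← Finset.sum_add_distrib, ← Finset.sum_add_distrib]
  refine Finset.sum_congr rfl fun q _ => ?_
  simp only [Pi.add_apply]
  ring

lemma simulate {n m k : ℕ} {R : Type} (g : (Fin m → ZMod 2) → ZMod 2) (hg : Stifled g k)
    (f : (Fin n → ZMod 2) → R → Prop) (T : PDTree (Fin n × Fin m) R) :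
    ∀ (Φ : (Fin n × Fin m → ZMod 2) → (Fin n × Fin m → ZMod 2))
      (F : Finset (Fin n × Fin m)) (Q : Finset (Fin n)) (x0 : Fin n → ZMod 2),
      Good g k Φ F Q x0 → (∀ i, i ∉ Q → (deadSet F i).card < k) →
      (∀ y, Compose f g (Φ y) (T.eval (Φ y))) →
      ∃ D : DTree (Fin n) R, (∀ x, (∀ i ∈ Q, x i = x0 i) → f x (D.eval x)) ∧
        D.depth * k ≤ T.depth + ∑ i ∈ Qᶜ, (deadSet F i).card := by
  induction T with
  | leaf r =>
    intro Φ F Q x0 G hlt hT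
    refine ⟨DTree.leaf r, ?_, by simp [DTree.depth]⟩
    intro x hx
    have hz : ∀ i, ∃ z : Fin m → ZMod 2, i ∉ Q → ∀ w : Fin m → ZMod 2,
        (∀ j, j ∉ deadSet F i → w j = z j) → g w = x i := by
      intro i
      by_cases hi : i ∈ Q
      · exact ⟨0, fun h => absurd hi h⟩
      · obtain ⟨z, hz⟩ := hg (deadSet F i) (G.small i hi) (x i)
        exact ⟨z, fun _ => hz⟩
    choose z hz using hz
    have h1 := hT (fun q => z q.1 q.2)
    have h2 : (fun i => g fun j => Φ (fun q => z q.1 q.2) (i, j)) = x := by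
      funext i
      by_cases hi : i ∈ Q
      · rw [G.val i hi, hx i hi]
      · apply hz i hi
        intro j hj
        have hj' : (i, j) ∈ F := by simpa [deadSet] using hj
        rw [G.free _ hj']
    unfold Compose at h1
    rw [h2] at h1
    exact h1
  | node P t0 t1 ih0 ih1 =>
    intro Φ F Q x0 G hlt hT
    have hl := aff3_parity P Φ G.aff
    set l : (Fin n × Fin m → ZMod 2) → ZMod 2 := fun y => ∑ q, P q * Φ y q with hldef
    have hdep : ∀ y y', (∀ p ∈ F, y p = y' p) → l y = l y' := by
      intro y y' h
      simp only [hldef, G.dep y y' h]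
    have hT0 : ∀ y, l y = 0 → Compose f g (Φ y) (t0.eval (Φ y)) := by
      intro y hy
      have h1 := hT y
      change (∑ q, P q * Φ y q) = 0 at hy
      simpa [PDTree.eval, hy] using h1
    have hT1 : ∀ y, l y = 1 → Compose f g (Φ y) (t1.eval (Φ y)) := by
      intro y hy
      have h1 := hT y
      change (∑ q, P q * Φ y q) = 1 at hy
      simpa [PDTree.eval, hy] using h1
    have hd0 : t0.depth + 1 ≤ (PDTree.node P t0 t1).depth := by simp [PDTree.depth]
    have hd1 : t1.depth + 1 ≤ (PDTree.node P t0 t1).depth := by simp [PDTree.depth]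
    by_cases hc : ∀ p, l (Pi.single p 1) = l 0
    · have hconst := aff3_const l hl hc
      rcases zmod2_cases (l 0) with h0 | h0
      · obtain ⟨D, hD, hDd⟩ := ih0 Φ F Q x0 G hlt fun y => hT0 y ((hconst y).trans h0)
        exact ⟨D, hD, by omega⟩
      · obtain ⟨D, hD, hDd⟩ := ih1 Φ F Q x0 G hlt fun y => hT1 y ((hconst y).trans h0)
        exact ⟨D, hD, by omega⟩
    · push Not at hc
      obtain ⟨p, hp⟩ := hc
      have hpF : p ∈ F := by
        by_contra hpF
        apply hp
        apply hdep
        intro q hq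
        have : q ≠ p := fun e => hpF (e ▸ hq)
        simp [Pi.single_apply, this]
      have hpQ : p.1 ∉ Q := fun h => G.dead p.1 h p.2 hpF
      have G' := good_erase G hlt l hl hdep p hpF hp
      have hT' : ∀ y, Compose f g (Φ (y + Pi.single p (l y)))
          (t0.eval (Φ (y + Pi.single p (l y)))) := by
        intro y
        apply hT0
        rw [aff3_flip l hl p hp, zmod2_add_self]
      have hsum : ∑ i ∈ Qᶜ, (deadSet (F.erase p) i).card
          = ∑ i ∈ Qᶜ, (deadSet F i).card + 1 := by
        have hm : p.1 ∈ Qᶜ := by simpa using hpQ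
        rw [← Finset.add_sum_erase _ _ hm, ← Finset.add_sum_erase Qᶜ _ hm,
          deadSet_erase_self F p hpF]
        have : ∑ i ∈ Qᶜ.erase p.1, (deadSet (F.erase p) i).card
            = ∑ i ∈ Qᶜ.erase p.1, (deadSet F i).card :=
          Finset.sum_congr rfl fun i hi => by
            rw [deadSet_erase_ne F p i (Finset.ne_of_mem_erase hi)]
        rw [this]
        ring
      have hltE : ∀ i, i ∉ insert p.1 Q → (deadSet (F.erase p) i).card < k := by
        intro i hi
        rw [Finset.mem_insert, not_or] at hi
        rw [deadSet_erase_ne F p i hi.1]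
        exact hlt i hi.2
      by_cases hk' : (deadSet (F.erase p) p.1).card < k
      · obtain ⟨D, hD, hDd⟩ := ih0 _ _ Q x0 G' (by
          intro i hi
          by_cases e : i = p.1
          · rw [e]; exact hk'
          · exact hltE i (by simp [e, hi])) hT'
        exact ⟨D, hD, by omega⟩
      · have hsum2 : ∑ i ∈ (insert p.1 Q)ᶜ,
            (deadSet ((F.erase p).filter fun q => q.1 ≠ p.1) i).card + k
            ≤ ∑ i ∈ Qᶜ, (deadSet (F.erase p) i).card := by
          have hm : p.1 ∈ Qᶜ := by simpa using hpQ
          rw [← Finset.add_sum_erase Qᶜ _ hm, Finset.compl_insert]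
          have : ∑ i ∈ Qᶜ.erase p.1, (deadSet ((F.erase p).filter fun q => q.1 ≠ p.1) i).card
              = ∑ i ∈ Qᶜ.erase p.1, (deadSet (F.erase p) i).card :=
            Finset.sum_congr rfl fun i hi => by
              have hne := Finset.ne_of_mem_erase hi
              congr 1
              ext j
              simp [deadSet, hne]
          rw [this]
          omega
        have step : ∀ b : ZMod 2, ∃ D : DTree (Fin n) R,
            (∀ x, (∀ i ∈ Q, x i = x0 i) → x p.1 = b → f x (D.eval x)) ∧
            D.depth * k + k ≤ t0.depth + ∑ i ∈ Qᶜ, (deadSet (F.erase p) i).card := by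
          intro b
          obtain ⟨z, hz⟩ := hg (deadSet (F.erase p) p.1) (G'.small p.1 hpQ) b
          have G'' := good_block G' p.1 hpQ b z hz
          obtain ⟨D, hD, hDd⟩ := ih0 _ _ _ _ G'' (by
            intro i hi
            have h2 := hltE i hi
            rw [Finset.mem_insert, not_or] at hi
            have : deadSet ((F.erase p).filter fun q => q.1 ≠ p.1) i
                = deadSet (F.erase p) i := by
              ext j
              simp [deadSet, hi.1]
            rw [this]
            exact h2) (fun y => hT' _)
          refine ⟨D, ?_, by omega⟩
          intro x hx hb
          apply hD
          intro i hi
          by_cases e : i = p.1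
          · subst e
            rw [Function.update_self, hb]
          · rw [Function.update_of_ne e]
            exact hx i ((Finset.mem_insert.1 hi).resolve_left e)
        obtain ⟨D0, hD0, hd0'⟩ := step 0
        obtain ⟨D1, hD1, hd1'⟩ := step 1
        refine ⟨DTree.node p.1 D0 D1, ?_, ?_⟩
        · intro x hx
          rcases zmod2_cases (x p.1) with h | h
          · simpa [DTree.eval, h] using hD0 x hx h
          · simpa [DTree.eval, h] using hD1 x hx h
        · simp only [DTree.depth, add_mul, one_mul]
          rcases max_choice D0.depth D1.depth with h | h <;> rw [h] <;> omega

/-- If `g` is `k`-stifled (`k ≥ 1`), then every parity decision tree computing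
the composed relation `f ∘ g` has depth at least `DT(f)·k`, i.e. `PDT(f ∘ g) ≥ DT(f)·k`. -/
theorem pdt_depth_lifting {n m k : ℕ} {R : Type} (hk : 1 ≤ k)
    (g : (Fin m → ZMod 2) → ZMod 2) (hg : Stifled g k)
    (f : (Fin n → ZMod 2) → R → Prop) :
    ∀ T : PDTree (Fin n × Fin m) R, T.Computes (Compose f g) →
      DTdepth f * k ≤ T.depth := by
  intro T hT
  obtain ⟨D, hD, hd⟩ := simulate g hg f T id Finset.univ ∅ 0
    { aff := fun _ _ _ => rfl
      free := fun _ _ _ => rfl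
      dep := fun y y' h => funext fun p => h p (Finset.mem_univ p)
      val := by simp
      dead := by simp
      small := by simp [deadSet] } (by intro i _; simp [deadSet]; omega) (fun y => hT y)
  have h1 : DTdepth f ≤ D.depth := Nat.sInf_le ⟨D, fun x => hD x (by simp), rfl⟩
  have h2 : D.depth * k ≤ T.depth := by simpa [deadSet] using hd
  exact (Nat.mul_le_mul_right k h1).trans h2
end

section
/- Let g : {0,1}^m → {0,1} be a k-stifled Boolean function (with k ≥ 1) and let f ⊆ {0,1}^n × R be a relation. Then NAPDT(f ∘ g) ≥ NADT(f)·k, i.e., every non-adaptive parity decision tree for f ∘ g makes at least NADT(f)·k parity queries. -/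
/-- If `g` is `k`-stifled (`k ≥ 1`), then every non-adaptive parity decision
tree computing the composed relation `f ∘ g` makes at least `NADT(f)·k` parity queries, i.e.
`NAPDT(f ∘ g) ≥ NADT(f)·k`. -/
theorem napdt_lifting {n m k : ℕ} {R : Type} (hk : 1 ≤ k)
    (g : (Fin m → ZMod 2) → ZMod 2) (hg : Stifled g k)
    (f : (Fin n → ZMod 2) → R → Prop) :
    ∀ (q : ℕ) (qs : Fin q → (Fin n × Fin m) → ZMod 2) (out : (Fin q → ZMod 2) → R),
      NAPDTComputes q qs out (Compose f g) → NADT f * k ≤ q := by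
  classical
  intro q qs out h
  -- columns of the query matrix
  let v : Fin n × Fin m → (Fin q → ZMod 2) := fun p t => qs t p
  let blk : Finset (Fin n × Fin m) → Fin n → Finset (Fin m) :=
    fun S i => Finset.univ.filter fun j => (i, j) ∈ S
  let good : Finset (Finset (Fin n × Fin m)) :=
    Finset.univ.filter fun S => LinearIndepOn (ZMod 2) v (S : Set (Fin n × Fin m)) ∧
      ∀ i, (blk S i).card ≤ k
  have hne : good.Nonempty := ⟨∅, by simp [good, blk]⟩
  obtain ⟨S, hS, hmax⟩ := Finset.exists_max_image good Finset.card hne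
  simp only [good, Finset.mem_filter, Finset.mem_univ, true_and] at hS hmax
  obtain ⟨hli, hblk⟩ := hS
  let I : Finset (Fin n) := Finset.univ.filter fun i => (blk S i).card = k
  -- columns outside the full blocks are spanned by the pivots
  have hspan : ∀ p : Fin n × Fin m, p.1 ∉ I → v p ∈ Submodule.span (ZMod 2) (v '' S) := by
    intro p hp
    by_contra hns
    have hpS : p ∉ S := fun hpS => hns (Submodule.subset_span ⟨p, hpS, rfl⟩)
    have h1 := hmax (insert p S) ⟨by
      rw [Finset.coe_insert]
      exact hli.insert hns, by
      intro i
      by_cases hi : i = p.1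
      · have h2 : blk (insert p S) i ⊆ insert p.2 (blk S i) := by
          intro j hj
          simp only [blk, Finset.mem_filter, Finset.mem_univ, true_and, Finset.mem_insert] at hj ⊢
          rcases hj with hj | hj
          · left; rw [← hj]
          · right; exact hj
        have h3 : (blk S i).card ≠ k := by
          intro h3
          exact hp (by simp only [I, Finset.mem_filter, Finset.mem_univ, true_and]; rw [← hi]; exact h3)
        have h4 := Finset.card_le_card h2
        have h5 := Finset.card_insert_le p.2 (blk S i)
        have h6 := hblk i
        omega
      · have h2 : blk (insert p S) i = blk S i := by
          ext j
          simp only [blk, Finset.mem_filter, Finset.mem_univ, true_and, Finset.mem_insert]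
          constructor
          · rintro (hj | hj)
            · exact absurd (by rw [← hj]) hi
            · exact hj
          · exact Or.inr
        rw [h2]; exact hblk i⟩
    rw [Finset.card_insert_of_notMem hpS] at h1
    omega
  have hcardS : S.card ≤ q := by
    have h1 := LinearIndependent.fintype_card_le_finrank hli
    simpa using h1
  have hcardI : I.card * k ≤ S.card := by
    have h1 : S.card = ∑ i, (blk S i).card := by
      rw [Finset.card_eq_sum_card_fiberwise (f := Prod.fst) (t := Finset.univ) (by simp)]
      refine Finset.sum_congr rfl fun i _ => ?_
      symm
      refine Finset.card_bij (fun j _ => (i, j)) ?_ ?_ ?_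
      · intro j hj; simpa [blk] using hj
      · intro a _ b _ hab; simpa using hab
      · rintro ⟨a, b⟩ hb
        simp only [Finset.mem_filter] at hb
        obtain ⟨hb, rfl⟩ := hb
        exact ⟨b, by simpa [blk] using hb, rfl⟩
    rw [h1]
    calc I.card * k = ∑ i ∈ I, (blk S i).card := by
          rw [Finset.sum_congr rfl (g := fun _ => k)]
          · simp
          · intro i hi; simpa [I] using hi
      _ ≤ _ := Finset.sum_le_sum_of_subset (Finset.subset_univ I)
  choose z hz using fun i => hg (blk S i) (hblk i)
  let A : (Fin n → ZMod 2) → Fin q → ZMod 2 := fun x =>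
    ∑ p ∈ Finset.univ.filter (fun p : Fin n × Fin m => p.1 ∈ I ∧ p ∉ S), z p.1 (x p.1) p.2 • v p
  have key : ∀ x, f x (out (A x)) := by
    intro x
    let T : Fin q → ZMod 2 :=
      ∑ p ∈ Finset.univ.filter (fun p : Fin n × Fin m => p.1 ∉ I ∧ p ∉ S), z p.1 (x p.1) p.2 • v p
    have hT : -T ∈ Submodule.span (ZMod 2) (v '' S) := by
      refine Submodule.neg_mem _ (Submodule.sum_mem _ fun p hp => Submodule.smul_mem _ _ (hspan p ?_))
      simp only [Finset.mem_filter] at hp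
      exact hp.2.1
    rw [Submodule.mem_span_image_finset_iff_exists_fun] at hT
    obtain ⟨c₀, hc₀⟩ := hT
    obtain ⟨c, hc⟩ : ∃ c : Fin n × Fin m → ZMod 2, ∑ p ∈ S, c p • v p = -T := by
      refine ⟨fun p => if hp : p ∈ S then c₀ ⟨p, hp⟩ else 0, ?_⟩
      rw [← hc₀, ← Finset.sum_coe_sort]
      refine Finset.sum_congr rfl fun p _ => ?_
      simp
    let y : Fin n × Fin m → ZMod 2 := fun p => if p ∈ S then c p else z p.1 (x p.1) p.2
    have hy := h y
    have hgy : (fun i => g fun j => y (i, j)) = x := by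
      funext i
      apply hz i (x i)
      intro j hj
      have : (i, j) ∉ S := by simpa [blk] using hj
      simp [y, this]
    have hans : (fun t => ∑ p, qs t p * y p) = A x := by
      have h1 : (fun t => ∑ p, qs t p * y p) = ∑ p, y p • v p := by
        funext t
        simp [v, Finset.sum_apply, mul_comm]
      have h2 : ∑ p, y p • v p = ∑ p ∈ S, c p • v p + (A x + T) := by
        have e1 : ∀ p, y p • v p = (if p ∈ S then c p • v p else 0) +
            ((if p.1 ∈ I ∧ p ∉ S then z p.1 (x p.1) p.2 • v p else 0) +
             (if p.1 ∉ I ∧ p ∉ S then z p.1 (x p.1) p.2 • v p else 0)) := by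
          intro p
          by_cases h1 : p ∈ S <;> by_cases h2 : p.1 ∈ I <;> simp [y, h1, h2]
        simp only [e1, Finset.sum_add_distrib, A, T, Finset.sum_filter]
        simp
      rw [h1, h2, hc]
      abel
    unfold Compose at hy
    rw [hgy, hans] at hy
    exact hy
  have hN : NADT f ≤ I.card := by
    apply Nat.sInf_le
    refine ⟨fun t => (I.equivFin.symm t).1,
      fun a => out (A fun i => if hi : i ∈ I then a (I.equivFin ⟨i, hi⟩) else 0), ?_⟩
    intro x
    have : A (fun i => if hi : i ∈ I then x (I.equivFin.symm (I.equivFin ⟨i, hi⟩)).1 else 0)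
        = A x := by
      refine Finset.sum_congr rfl fun p hp => ?_
      simp only [Finset.mem_filter] at hp
      simp [hp.2.1]
    have h2 := key x
    rw [← this] at h2
    exact h2
  calc NADT f * k ≤ I.card * k := Nat.mul_le_mul_right k hN
    _ ≤ S.card := hcardI
    _ ≤ q := hcardS
end

section
/- For every integer m ≥ 1, the Indexing function IND_m : {0,1}^{m+2^m} → {0,1} is m-stifled. -/
/-- For every integer `m ≥ 1`, the Indexing function `IND_m` is `m`-stifled. -/
theorem IND_is_stifled (m : ℕ) (hm : 1 ≤ m) : Stifled (IND m) m := by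
  classical
  intro S hS b
  have hinj : Function.Injective (binIndex (m := m)) := by
    intro x y h
    have h' := finFunctionFinEquiv.injective h
    funext i
    have h2 := congrFun h' i
    simp only [Fin.mk.injEq] at h2
    exact ZMod.val_injective 2 h2
  let F := {i : Fin m // i ∉ S.toLeft}
  let dec : Fin (2 ^ m) → (F → ZMod 2) := fun j i => Function.invFun binIndex j i.1
  have hF : Fintype.card F = m - S.toLeft.card := by
    rw [Fintype.card_subtype_compl, Fintype.card_fin, Fintype.card_coe]
  have hcard : S.toRight.card ≤ Fintype.card F := by
    have := S.card_toLeft_add_card_toRight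
    omega
  have hex : ∃ u : F → ZMod 2, u ∉ S.toRight.image dec := by
    by_contra! hc
    have h1 : Fintype.card (F → ZMod 2) ≤ (S.toRight.image dec).card := by
      rw [← Finset.card_univ]
      exact Finset.card_le_card fun u _ => hc u
    have h2 := Finset.card_image_le (s := S.toRight) (f := dec)
    rw [Fintype.card_fun, ZMod.card] at h1
    have h3 := Nat.lt_two_pow_self (n := Fintype.card F)
    omega
  obtain ⟨u, hu⟩ := hex
  refine ⟨Sum.elim (fun i => if h : i ∉ S.toLeft then u ⟨i, h⟩ else 0) (fun _ => b), ?_⟩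
  intro x hx
  unfold IND
  rw [hx]
  · rfl
  · intro hmem
    apply hu
    refine Finset.mem_image.2 ⟨_, Finset.mem_toRight.2 hmem, ?_⟩
    funext i
    have hi : Sum.inl i.1 ∉ S := fun h => i.2 (Finset.mem_toLeft.2 h)
    have hl := congrFun (Function.leftInverse_invFun hinj (fun i => x (Sum.inl i))) i.1
    have := hx _ hi
    simp only [dec]
    rw [hl, this, Sum.elim_inl, dif_pos i.2]
end

section
/- For every integer m ≥ 1, the Indexing function IND_m : {0,1}^{m+2^m} → {0,1} is not (m+1)-stifled: taking S to be the set consisting of all m addressing variables together with a single target variable, for every assignment to the remaining variables the restricted function is non-constant. -/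
theorem binIndex_surj {m : ℕ} (j : Fin (2 ^ m)) : ∃ a : Fin m → ZMod 2, binIndex a = j := by
  refine ⟨fun i => ((finFunctionFinEquiv.symm j : Fin m → Fin 2) i : ZMod 2), ?_⟩
  unfold binIndex
  rw [← Equiv.eq_symm_apply]
  funext i
  rfl

theorem IND_nonconst (m : ℕ) (j : Fin (2 ^ m)) (z : (Fin m ⊕ Fin (2 ^ m)) → ZMod 2) :
      ∃ x x' : (Fin m ⊕ Fin (2 ^ m)) → ZMod 2,
        (∀ i, i ∉ (Finset.univ.image Sum.inl ∪ {Sum.inr j} :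
            Finset (Fin m ⊕ Fin (2 ^ m))) → x i = z i) ∧
        (∀ i, i ∉ (Finset.univ.image Sum.inl ∪ {Sum.inr j} :
            Finset (Fin m ⊕ Fin (2 ^ m))) → x' i = z i) ∧
        IND m x ≠ IND m x' := by
  obtain ⟨a, ha⟩ := binIndex_surj j
  have key : ∀ b : ZMod 2, ∃ x : (Fin m ⊕ Fin (2 ^ m)) → ZMod 2,
      (∀ i, i ∉ (Finset.univ.image Sum.inl ∪ {Sum.inr j} :
            Finset (Fin m ⊕ Fin (2 ^ m))) → x i = z i) ∧ IND m x = b := by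
    intro b
    refine ⟨Sum.elim a (fun k => if k = j then b else z (Sum.inr k)), ?_, ?_⟩
    · rintro (i | k) hi
      · simp at hi
      · have hk : k ≠ j := by simpa using hi
        simp [hk]
    · simp [IND, ha]
  obtain ⟨x, hx, h0⟩ := key 0
  obtain ⟨x', hx', h1⟩ := key 1
  exact ⟨x, x', hx, hx', by rw [h0, h1]; decide⟩

/-- For every integer `m ≥ 1`, `IND_m` is not `(m+1)`-stifled: taking `S` to be
the set of all `m` addressing variables together with a single target variable, for every
assignment to the remaining variables the restricted function is non-constant. -/
theorem IND_not_stifled (m : ℕ) (hm : 1 ≤ m) :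
    ¬ Stifled (IND m) (m + 1) ∧
    ∀ j : Fin (2 ^ m), ∀ z : (Fin m ⊕ Fin (2 ^ m)) → ZMod 2,
      ∃ x x' : (Fin m ⊕ Fin (2 ^ m)) → ZMod 2,
        (∀ i, i ∉ (Finset.univ.image Sum.inl ∪ {Sum.inr j} :
            Finset (Fin m ⊕ Fin (2 ^ m))) → x i = z i) ∧
        (∀ i, i ∉ (Finset.univ.image Sum.inl ∪ {Sum.inr j} :
            Finset (Fin m ⊕ Fin (2 ^ m))) → x' i = z i) ∧
        IND m x ≠ IND m x' := by
  refine ⟨fun h => ?_, IND_nonconst m⟩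
  let j : Fin (2 ^ m) := ⟨0, by positivity⟩
  obtain ⟨z, hz⟩ := h (Finset.univ.image Sum.inl ∪ {Sum.inr j}) (by
    refine (Finset.card_union_le _ _).trans ?_
    have := Finset.card_image_le (s := (Finset.univ : Finset (Fin m)))
      (f := (Sum.inl : Fin m → Fin m ⊕ Fin (2 ^ m)))
    simp only [Finset.card_univ, Fintype.card_fin] at this
    simpa using this) 0
  obtain ⟨x, x', hx, hx', hne⟩ := IND_nonconst m j z
  exact hne ((hz x hx).trans (hz x' hx').symm)
end

section
/- For every integer m ≥ 2, the Inner Product Modulo 2 function IP_m : {0,1}^{2m} → {0,1} is 1-stifled. -/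
/-- For every integer `m ≥ 2`, the Inner Product Modulo 2 function `IP_m`
is `1`-stifled. -/
theorem IP_is_stifled (m : ℕ) (hm : 2 ≤ m) : Stifled (IP m) 1 := by
  intro S hS b
  rw [Finset.card_le_one] at hS
  obtain ⟨j, hj1, hj2⟩ : ∃ j : Fin m, Sum.inl j ∉ S ∧ Sum.inr j ∉ S := by
    by_contra hcon
    push Not at hcon
    have h0 := hcon ⟨0, by omega⟩
    have h1 := hcon ⟨1, by omega⟩
    by_cases a0 : Sum.inl (⟨0, by omega⟩ : Fin m) ∈ S <;>
      by_cases a1 : Sum.inl (⟨1, by omega⟩ : Fin m) ∈ S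
    · simpa using hS _ a0 _ a1
    · simpa using hS _ a0 _ (h1 a1)
    · simpa using hS _ (h0 a0) _ a1
    · simpa using hS _ (h0 a0) _ (h1 a1)
  refine ⟨Sum.elim (fun i => if i = j then 1 else 0) (fun i => if i = j then b else 0), ?_⟩
  intro x hx
  unfold IP
  rw [Finset.sum_eq_single j]
  · rw [hx _ hj1, hx _ hj2]
    simp
  · intro i _ hij
    by_cases hi : Sum.inl i ∈ S
    · have hr : Sum.inr i ∉ S := fun h => by simpa using hS _ hi _ h
      rw [hx _ hr]
      simp [hij]
    · rw [hx _ hi]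
      simp [hij]
  · intro h
    exact absurd (Finset.mem_univ j) h
end

section
/- Let g : {0,1}^m → {0,1} be a uniformly random Boolean function (each of the 2^m output values chosen independently and uniformly in {0,1}), with m sufficiently large. Then with probability at least 9/10, g is ((log₂ m)/2)-stifled. -/
lemma pred_pow_aux (n j : ℕ) : n ^ j * (n + j) ≤ n * (n + 1) ^ j := by
  induction j with
  | zero => simp
  | succ j ih =>
    calc n ^ (j + 1) * (n + (j + 1)) = n ^ j * (n * (n + j + 1)) := by ring
      _ ≤ n ^ j * ((n + j) * (n + 1)) := Nat.mul_le_mul_left _ (by nlinarith)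
      _ = (n ^ j * (n + j)) * (n + 1) := by ring
      _ ≤ (n * (n + 1) ^ j) * (n + 1) := by gcongr
      _ = _ := by ring

lemma pred_pow_le (n : ℕ) : n ^ (n + 1) * 2 ≤ (n + 1) ^ (n + 1) := by
  calc n ^ (n + 1) * 2 = n ^ n * (n + n) := by ring
    _ ≤ n * (n + 1) ^ n := pred_pow_aux n n
    _ ≤ (n + 1) * (n + 1) ^ n := by gcongr; omega
    _ = _ := by ring

open Classical in
lemma bad_card_le (m : ℕ) (S : Finset (Fin m)) (b : ZMod 2) :
    (Finset.univ.filter fun g : (Fin m → ZMod 2) → ZMod 2 =>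
      ¬ ∃ z : Fin m → ZMod 2, ∀ x : Fin m → ZMod 2, (∀ i, i ∉ S → x i = z i) → g x = b).card
      ≤ (2 ^ (2 ^ S.card) - 1) ^ (2 ^ (m - S.card)) := by
  let e := Equiv.piEquivPiSubtypeProd (fun i => i ∈ S) (fun _ : Fin m => ZMod 2)
  let T : Finset (({i // i ∉ S} → ZMod 2) → (({i // i ∈ S} → ZMod 2) → ZMod 2)) :=
    Fintype.piFinset (fun _ => Finset.univ.erase (fun _ => b))
  have hT : T.card = (2 ^ (2 ^ S.card) - 1) ^ (2 ^ (m - S.card)) := by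
    have h1 : Fintype.card {i // i ∉ S} = m - S.card := by
      rw [Fintype.card_subtype_compl]; simp
    simp [T, Fintype.card_piFinset, Finset.card_erase_of_mem, ZMod.card, h1]
  rw [← hT]
  refine Finset.card_le_card_of_injOn (fun g z y => g (e.symm (y, z))) ?_ ?_
  · intro g hg
    simp only [Finset.coe_filter, Finset.mem_univ, true_and, Set.mem_ofPred_eq] at hg
    simp only [T, Finset.mem_coe, Fintype.mem_piFinset, Finset.mem_erase, Finset.mem_univ,
      and_true]
    intro z hz
    apply hg
    refine ⟨e.symm (fun _ => 0, z), fun x hx => ?_⟩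
    have h2 : x = e.symm ((e x).1, z) := by
      rw [Equiv.eq_symm_apply]
      ext i
      · rfl
      · have := hx i.1 i.2
        simp [e, Equiv.piEquivPiSubtypeProd, i.2] at this ⊢
        exact this
    rw [h2]
    exact congrFun hz _
  · intro g _ g' _ h
    funext x
    have := congrFun (congrFun h (e x).2) (e x).1
    simpa using this

lemma num_aux (m s : ℕ) (hm : 64 ≤ m) (hs : s ≤ Nat.log 2 m / 2) :
    s + 2 ^ s ≤ m ∧ m + 5 ≤ 2 ^ (m - s - 2 ^ s) := by
  have h1 : 2 ^ s * 2 ^ s ≤ m := by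
    rw [← pow_add]
    exact (Nat.pow_le_pow_right (by norm_num) (by omega)).trans
      (Nat.pow_log_le_self 2 (by omega))
  have h2 : s < 2 ^ s := Nat.lt_two_pow_self
  generalize 2 ^ s = K at *
  have h3 : 8 * K ≤ m := by
    by_cases h : 8 ≤ K
    · nlinarith
    · omega
  refine ⟨by omega, ?_⟩
  have h4 : m / 2 ≤ m - s - K := by omega
  refine le_trans ?_ (Nat.pow_le_pow_right (by norm_num) h4)
  have h5 : ∀ n, 32 ≤ n → 2 * n + 6 ≤ 2 ^ n := by
    intro n hn
    induction n, hn using Nat.le_induction with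
    | base => norm_num
    | succ n hn ih => rw [pow_succ]; omega
  have := h5 (m / 2) (by omega)
  omega

lemma bad_num (m s : ℕ) (hm : 64 ≤ m) (hs : s ≤ Nat.log 2 m / 2) :
    (2 ^ (2 ^ s) - 1) ^ (2 ^ (m - s)) * 2 ^ (m + 5) ≤ 2 ^ (2 ^ m) := by
  obtain ⟨h1, h2⟩ := num_aux m s hm hs
  obtain ⟨n, hn⟩ : ∃ n, 2 ^ (2 ^ s) = n + 1 := Nat.exists_eq_succ_of_ne_zero (by positivity)
  have hpos : 0 < 2 ^ s := by positivity
  have e1 : 2 ^ (m - s) = (n + 1) * 2 ^ (m - s - 2 ^ s) := by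
    rw [← hn, ← pow_add, Nat.sub_sub]; congr 1
    generalize 2 ^ s = K at *; omega
  have e2 : 2 ^ m = 2 ^ s * 2 ^ (m - s) := by
    rw [← pow_add]; congr 1
    have : s ≤ m := le_trans (Nat.le_add_right _ _) h1
    omega
  calc (2 ^ (2 ^ s) - 1) ^ (2 ^ (m - s)) * 2 ^ (m + 5)
      ≤ (2 ^ (2 ^ s) - 1) ^ (2 ^ (m - s)) * 2 ^ (2 ^ (m - s - 2 ^ s)) := by
        gcongr; norm_num
    _ = (n ^ (n + 1) * 2) ^ (2 ^ (m - s - 2 ^ s)) := by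
        rw [hn, Nat.add_sub_cancel, e1, mul_pow, pow_mul]
    _ ≤ ((n + 1) ^ (n + 1)) ^ (2 ^ (m - s - 2 ^ s)) := by
        gcongr; exact pred_pow_le n
    _ = 2 ^ (2 ^ m) := by
        rw [e2, pow_mul, hn, e1, pow_mul]

open Classical in
lemma nonstifled_card (m : ℕ) (hm : 64 ≤ m) :
    (Finset.univ.filter fun g : (Fin m → ZMod 2) → ZMod 2 =>
      ¬ Stifled g (Nat.log 2 m / 2)).card * 16 ≤ 2 ^ (2 ^ m) := by
  set k := Nat.log 2 m / 2 with hk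
  let P : Finset (Finset (Fin m) × ZMod 2) := Finset.univ.filter fun p => p.1.card ≤ k
  let B : Finset (Fin m) × ZMod 2 → Finset ((Fin m → ZMod 2) → ZMod 2) := fun p =>
    Finset.univ.filter fun g : (Fin m → ZMod 2) → ZMod 2 =>
      ¬ ∃ z : Fin m → ZMod 2, ∀ x : Fin m → ZMod 2, (∀ i, i ∉ p.1 → x i = z i) → g x = p.2
  have hsub : (Finset.univ.filter fun g : (Fin m → ZMod 2) → ZMod 2 => ¬ Stifled g k)
      ⊆ P.biUnion B := by
    intro g hg
    simp only [Finset.mem_filter, Finset.mem_univ, true_and] at hg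
    unfold Stifled at hg
    rw [not_forall] at hg
    obtain ⟨S, hS⟩ := hg
    rw [Classical.not_imp, not_forall] at hS
    obtain ⟨hS, b, hb⟩ := hS
    simp only [Finset.mem_biUnion]
    exact ⟨(S, b), by simp [P, hS], by simp only [B, Finset.mem_filter]; exact ⟨Finset.mem_univ _, hb⟩⟩
  have hP : P.card ≤ 2 ^ (m + 1) := by
    refine (Finset.card_filter_le _ _).trans ?_
    simp [ZMod.card, pow_succ]
  have hB : ∀ p ∈ P, (B p).card * 2 ^ (m + 5) ≤ 2 ^ (2 ^ m) := by
    intro p hp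
    have hp' : p.1.card ≤ k := by simpa [P] using hp
    exact (Nat.mul_le_mul_right _ (bad_card_le m p.1 p.2)).trans (bad_num m _ hm hp')
  have h1 := (Finset.card_le_card hsub).trans Finset.card_biUnion_le
  have h2 : (∑ p ∈ P, (B p).card) * 2 ^ (m + 5) ≤ 2 ^ (m + 1) * 2 ^ (2 ^ m) := by
    rw [Finset.sum_mul]
    calc _ ≤ ∑ p ∈ P, 2 ^ (2 ^ m) := Finset.sum_le_sum hB
      _ = P.card * 2 ^ (2 ^ m) := by simp
      _ ≤ _ := by gcongr
  have h3 := (Nat.mul_le_mul_right (2 ^ (m + 5)) h1).trans h2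
  refine le_of_mul_le_mul_left (a := 2 ^ (m + 1)) ?_ (by positivity)
  refine le_trans (le_of_eq ?_) h3
  ring

open Classical in
/-- For all sufficiently large `m`, a uniformly random Boolean function on `m`
input bits is `((log₂ m)/2)`-stifled with probability at least `9/10` (the probability is the
fraction of all `2^(2^m)` Boolean functions on `m` bits that are `((log₂ m)/2)`-stifled). -/
theorem random_function_stifled :
    ∃ M : ℕ, ∀ m : ℕ, M ≤ m →
      (9 : ℚ) / 10 ≤
        ((Finset.univ.filter fun g : (Fin m → ZMod 2) → ZMod 2 =>
            Stifled g (Nat.log 2 m / 2)).card : ℚ) /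
          ((Finset.univ : Finset ((Fin m → ZMod 2) → ZMod 2)).card : ℚ) := by
  refine ⟨64, fun m hm => ?_⟩
  have h1 := nonstifled_card m hm
  have h2 := Finset.card_filter_add_card_filter_not
    (s := (Finset.univ : Finset ((Fin m → ZMod 2) → ZMod 2)))
    (fun g => Stifled g (Nat.log 2 m / 2))
  have h3 : (Finset.univ : Finset ((Fin m → ZMod 2) → ZMod 2)).card = 2 ^ (2 ^ m) := by
    simp [ZMod.card]
  rw [← h3] at h1
  have h4 : 0 < (Finset.univ : Finset ((Fin m → ZMod 2) → ZMod 2)).card := by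
    rw [h3]; positivity
  rw [div_le_div_iff₀ (by norm_num) (by exact_mod_cast h4)]
  have h5 : 9 * (Finset.univ : Finset ((Fin m → ZMod 2) → ZMod 2)).card ≤
      (Finset.univ.filter fun g : (Fin m → ZMod 2) → ZMod 2 =>
            Stifled g (Nat.log 2 m / 2)).card * 10 := by
    omega
  exact_mod_cast h5
end

section
/- For every relation F ⊆ {0,1}^n × R, sDT(F) ≤ 2·log₂ PDTsize(F); more precisely, sDT(F) ≤ log_{3/2} PDTsize(F). -/
/-- The affine hyperplane `⟨P, x⟩ = b`. -/
def parityHyperplane {ι : Type} [Fintype ι] (P : ι → ZMod 2) (b : ZMod 2) :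
    AffineSubspace (ZMod 2) (ι → ZMod 2) where
  carrier := {x | ∑ i, P i * x i = b}
  smul_vsub_vadd_mem' := by
    intro c p1 p2 p3 h1 h2 h3
    simp only [Set.mem_setOf_eq] at *
    have : ∑ i, P i * (c • (p1 -ᵥ p2) +ᵥ p3) i
        = c * (∑ i, P i * p1 i - ∑ i, P i * p2 i) + ∑ i, P i * p3 i := by
      rw [← Finset.sum_sub_distrib, Finset.mul_sum, ← Finset.sum_add_distrib]
      refine Finset.sum_congr rfl fun i _ => ?_
      simp only [vsub_eq_sub, vadd_eq_add, Pi.add_apply, Pi.smul_apply, Pi.sub_apply, smul_eq_mul]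
      ring
    rw [this, h1, h2, h3]
    simp

theorem mem_parityHyperplane {ι : Type} [Fintype ι] (P : ι → ZMod 2) (b : ZMod 2)
    (x : ι → ZMod 2) : x ∈ parityHyperplane P b ↔ ∑ i, P i * x i = b := Iff.rfl

theorem zmod_two_ne_one (a : ZMod 2) : a = 0 ↔ ¬ a = 1 := by
  revert a; decide

theorem PDTree.size_pos' {ι R : Type} (T : PDTree ι R) : 1 ≤ T.size := by
  induction T with
  | leaf r => simp [PDTree.size]
  | node P t0 t1 h0 h1 => simp only [PDTree.size]; omega

/-- Balanced cut of a parity decision tree. -/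
theorem PDTree.cut {ι R : Type} [Fintype ι] (s : ℕ) (hs : 2 ≤ s) (T : PDTree ι R) :
    2 * s < 3 * T.size → ∃ (A : AffineSubspace (ZMod 2) (ι → ZMod 2)) (U V : PDTree ι R),
      (∀ x, x ∈ A → T.eval x = U.eval x) ∧ (∀ x, x ∉ A → T.eval x = V.eval x) ∧
      U.size + V.size = T.size ∧ 3 * U.size ≤ 2 * s ∧ s ≤ 3 * U.size := by
  induction T with
  | leaf r => intro h; simp only [PDTree.size] at h; omega
  | node P t0 t1 h0 h1 =>
    intro h
    simp only [PDTree.size] at h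
    rcases le_total t0.size t1.size with hle | hle
    · by_cases hc : 3 * t1.size ≤ 2 * s
      · refine ⟨parityHyperplane P 1, t1, t0, ?_, ?_, ?_, hc, by omega⟩
        · intro x hx
          rw [mem_parityHyperplane] at hx
          simp [PDTree.eval, hx]
        · intro x hx
          rw [mem_parityHyperplane] at hx
          simp [PDTree.eval, hx]
        · simp only [PDTree.size]; omega
      · obtain ⟨A, U, V, hU, hV, hsz, ha, hb⟩ := h1 (by omega)
        refine ⟨A ⊓ parityHyperplane P 1, U, .node P t0 V, ?_, ?_, ?_, ha, hb⟩
        · rintro x ⟨hx, hx'⟩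
          replace hx' := (mem_parityHyperplane P 1 x).1 hx'
          simp [PDTree.eval, hx', hU x hx]
        · intro x hx
          simp only [AffineSubspace.mem_inf_iff, mem_parityHyperplane, not_and] at hx
          by_cases hp : ∑ i, P i * x i = 1
          · simp [PDTree.eval, hp, hV x (fun h => hx h hp)]
          · simp [PDTree.eval, hp]
        · simp only [PDTree.size]; omega
    · by_cases hc : 3 * t0.size ≤ 2 * s
      · refine ⟨parityHyperplane P 0, t0, t1, ?_, ?_, ?_, hc, by omega⟩
        · intro x hx
          rw [mem_parityHyperplane, zmod_two_ne_one] at hx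
          simp [PDTree.eval, hx]
        · intro x hx
          rw [mem_parityHyperplane, zmod_two_ne_one, not_not] at hx
          simp [PDTree.eval, hx]
        · simp only [PDTree.size]
      · obtain ⟨A, U, V, hU, hV, hsz, ha, hb⟩ := h0 (by omega)
        refine ⟨A ⊓ parityHyperplane P 0, U, .node P V t1, ?_, ?_, ?_, ha, hb⟩
        · rintro x ⟨hx, hx'⟩
          replace hx' := (zmod_two_ne_one _).1 ((mem_parityHyperplane P 0 x).1 hx')
          simp [PDTree.eval, hx', hU x hx]
        · intro x hx
          simp only [AffineSubspace.mem_inf_iff, mem_parityHyperplane, not_and,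
            zmod_two_ne_one] at hx
          by_cases hp : ∑ i, P i * x i = 1
          · simp [PDTree.eval, hp]
          · simp [PDTree.eval, hp, hV x (fun h => hx h hp)]
        · simp only [PDTree.size]; omega

/-- Every PDT of size `s` is simulated by an sDT of depth `d` with `(3/2)^d ≤ s`. -/
theorem PDTree.exists_sdt {ι R : Type} [Fintype ι] (s : ℕ) : ∀ T : PDTree ι R, T.size = s →
    ∃ S : SDTree ι R, (∀ x, S.eval x = T.eval x) ∧ 3 ^ S.depth ≤ s * 2 ^ S.depth := by
  induction s using Nat.strong_induction_on with
  | _ s ih =>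
    intro T hT
    by_cases hs : 2 ≤ s
    · obtain ⟨A, U, V, hU, hV, hsz, ha, hb⟩ := PDTree.cut s hs T (by omega)
      have hUp := U.size_pos'
      have hVp := V.size_pos'
      obtain ⟨S1, hS1, hd1⟩ := ih U.size (by omega) U rfl
      obtain ⟨S0, hS0, hd0⟩ := ih V.size (by omega) V rfl
      refine ⟨.node A S0 S1, ?_, ?_⟩
      · intro x
        by_cases hx : x ∈ A
        · simp [SDTree.eval, hx, hS1, hU x hx]
        · simp [SDTree.eval, hx, hS0, hV x hx]
      · have key : ∀ u d : ℕ, 3 * u ≤ 2 * s → 3 ^ d ≤ u * 2 ^ d →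
            3 ^ (d + 1) ≤ s * 2 ^ (d + 1) := by
          intro u d hu hd
          calc 3 ^ (d + 1) = 3 * 3 ^ d := by ring
            _ ≤ 3 * (u * 2 ^ d) := by gcongr
            _ = (3 * u) * 2 ^ d := by ring
            _ ≤ (2 * s) * 2 ^ d := by gcongr
            _ = s * 2 ^ (d + 1) := by ring
        simp only [SDTree.depth]
        rcases max_choice S0.depth S1.depth with h | h
        · rw [h]; exact key V.size _ (by omega) hd0
        · rw [h]; exact key U.size _ (by omega) hd1
    · cases T with
      | leaf r =>
        simp only [PDTree.size] at hT
        exact ⟨.leaf r, fun x => rfl, by simp [SDTree.depth, ← hT]⟩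
      | node P t0 t1 =>
        have h0 := t0.size_pos'
        have h1 := t1.size_pos'
        simp only [PDTree.size] at hT
        omega

/-- A relation with a total choice function is computed by some PDT. -/
theorem exists_pdt_of_total {n : ℕ} {R : Type} (F : (Fin n → ZMod 2) → R → Prop)
    (f : (Fin n → ZMod 2) → R) (hf : ∀ x, F x (f x)) : ∃ T : PDTree (Fin n) R, T.Computes F := by
  have main : ∀ L : Finset (Fin n), ∀ f : (Fin n → ZMod 2) → R,
      (∀ x y, (∀ i ∈ L, x i = y i) → f x = f y) → ∃ T : PDTree (Fin n) R, ∀ x, T.eval x = f x := by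
    intro L
    induction L using Finset.induction_on with
    | empty => exact fun f h => ⟨.leaf (f 0), fun x => h _ _ (by simp)⟩
    | insert a L ha ih =>
      intro f h
      have hu : ∀ b : ZMod 2, ∃ T : PDTree (Fin n) R, ∀ x,
          T.eval x = f (Function.update x a b) := by
        intro b
        refine ih (fun x => f (Function.update x a b)) ?_
        intro x y hxy
        apply h
        intro i hi
        by_cases hia : i = a
        · subst hia; simp
        · simp only [Function.update_of_ne hia]
          exact hxy i (by simpa [hia] using hi)
      obtain ⟨T0, h0⟩ := hu 0
      obtain ⟨T1, h1⟩ := hu 1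
      refine ⟨.node (Pi.single a 1) T0 T1, fun x => ?_⟩
      have hsum : ∑ i, (Pi.single a 1 : Fin n → ZMod 2) i * x i = x a := by
        simp [Pi.single_apply]
      simp only [PDTree.eval, hsum]
      by_cases hx : x a = 1
      · rw [if_pos hx, h1, ← hx, Function.update_eq_self]
      · rw [if_neg hx, h0, ← (zmod_two_ne_one _).2 hx, Function.update_eq_self]
  obtain ⟨T, hT⟩ := main Finset.univ f (fun x y h => by rw [funext fun i => h i (Finset.mem_univ i)])
  exact ⟨T, fun x => by rw [hT]; exact hf x⟩

/-- For every relation `F ⊆ {0,1}ⁿ × R`, `sDT(F) ≤ 2·log₂ PDTsize(F)`;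
more precisely, `sDT(F) ≤ log_{3/2} PDTsize(F)`. -/
theorem sdt_le_log_pdtsize {n : ℕ} {R : Type} (F : (Fin n → ZMod 2) → R → Prop) :
    (SDTdepth F : ℝ) ≤ 2 * Real.logb 2 (PDTsizeMin F : ℝ) ∧
    (SDTdepth F : ℝ) ≤ Real.logb (3 / 2) (PDTsizeMin F : ℝ) := by
  by_cases hne : ∃ T : PDTree (Fin n) R, T.Computes F
  · obtain ⟨T0, hT0⟩ := hne
    have hmem : PDTsizeMin F ∈ {s | ∃ T : PDTree (Fin n) R, T.Computes F ∧ T.size = s} :=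
      Nat.sInf_mem ⟨_, T0, hT0, rfl⟩
    obtain ⟨T, hT, hsz⟩ := hmem
    obtain ⟨S, hS, hd⟩ := PDTree.exists_sdt _ T hsz
    have hle : SDTdepth F ≤ S.depth :=
      Nat.sInf_le ⟨S, fun x => by rw [hS]; exact hT x, rfl⟩
    have hpos : 1 ≤ PDTsizeMin F := hsz ▸ T.size_pos'
    generalize PDTsizeMin F = s at *
    generalize S.depth = d at *
    have hle' : (SDTdepth F : ℝ) ≤ d := by exact_mod_cast hle
    have hs0 : (0 : ℝ) < s := by exact_mod_cast hpos
    have hd' : ((3 : ℝ) / 2) ^ d ≤ s := by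
      rw [div_pow, div_le_iff₀ (by positivity)]
      exact_mod_cast hd
    constructor
    · refine hle'.trans ?_
      have h2 : (2 : ℝ) ^ d ≤ (s : ℝ) ^ 2 := by
        calc (2 : ℝ) ^ d ≤ ((3 / 2) ^ 2) ^ d := by gcongr; norm_num
          _ = ((3 / 2) ^ d) ^ 2 := by rw [← pow_mul, ← pow_mul, mul_comm]
          _ ≤ (s : ℝ) ^ 2 := by gcongr
      have h3 : (d : ℝ) ≤ Real.logb 2 ((s : ℝ) ^ 2) := by
        rw [Real.le_logb_iff_rpow_le (by norm_num) (by positivity), Real.rpow_natCast]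
        exact h2
      rw [Real.logb_pow] at h3
      exact_mod_cast h3
    · refine hle'.trans ?_
      rw [Real.le_logb_iff_rpow_le (by norm_num) hs0, Real.rpow_natCast]
      exact hd'
  · have h1 : SDTdepth F = 0 := by
      unfold SDTdepth
      rw [Nat.sInf_eq_zero]
      right
      rw [Set.eq_empty_iff_forall_notMem]
      rintro d ⟨S, hS, -⟩
      exact hne (exists_pdt_of_total F S.eval hS)
    have h2 : PDTsizeMin F = 0 := by
      unfold PDTsizeMin
      rw [Nat.sInf_eq_zero]
      right
      rw [Set.eq_empty_iff_forall_notMem]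
      rintro d ⟨T, hT, -⟩
      exact hne ⟨T, hT⟩
    simp [h1, h2]
end
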